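/- Fix a ∈ [0,1), σ > 0, ε ∈ (0,1) and d ∈ (0, d_max). For every constant α > 0 there exist constants κ > 0 and C > 0 such that for all sufficiently large n, the minimum achievable source coding rate of the Gauss-Markov source satisfies R(n, d, ε) ≤ R_U(d) + √(V_U(d)/n)·Q⁻¹(ε) + C/((log n)^{κα}·√n). -/

import Mathlib

open MeasureTheory ProbabilityTheory Real Filter Matrix
open scoped NNReal ENNReal

noncomputable section

namespace GM

/-- Law of `n` i.i.d. centered Gaussian random variables with variance `σ²`. -/
def gaussPi (σ : ℝ) (n : ℕ) : Measure (Fin n → ℝ) :=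
  Measure.pi fun _ => gaussianReal 0 ⟨σ ^ 2, sq_nonneg σ⟩

/-- The Gauss-Markov evolution `U_{i+1} = ∑_{j ≤ i} a^(i-j) Z_{j+1}`
(equivalently `U_0 = 0`, `U_i = a U_{i-1} + Z_i`). -/
def evolve (a : ℝ) (n : ℕ) (z : Fin n → ℝ) : Fin n → ℝ :=
  fun i => ∑ j ∈ Finset.Iic i, a ^ ((i : ℕ) - (j : ℕ)) * z j

/-- Law of the Gauss-Markov source vector `(U_1, …, U_n)`. -/
def sourceLaw (a σ : ℝ) (n : ℕ) : Measure (Fin n → ℝ) :=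
  (gaussPi σ n).map (evolve a n)

/-- Mean squared error distortion. -/
def distortion (n : ℕ) (u v : Fin n → ℝ) : ℝ :=
  (1 / (n : ℝ)) * ∑ i, (u i - v i) ^ 2

/-- There exists an `(n, M, d, ε)` excess-distortion code for the Gauss-Markov source. -/
def IsCode (a σ : ℝ) (n M : ℕ) (d ε : ℝ) : Prop :=
  ∃ f : (Fin n → ℝ) → Fin M, ∃ g : Fin M → (Fin n → ℝ),
    Measurable f ∧
    sourceLaw a σ n {u | d < distortion n u (g (f u))} ≤ ENNReal.ofReal ε

/-- Minimum achievable code size. -/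
def Mstar (a σ : ℝ) (n : ℕ) (d ε : ℝ) : ℕ := sInf {M | IsCode a σ n M d ε}

/-- Minimum achievable source coding rate `R(n, d, ε)`. -/
def rate (a σ : ℝ) (n : ℕ) (d ε : ℝ) : ℝ := Real.log (Mstar a σ n d ε) / n

/-- Gaussian tail function `Q`. -/
def gaussQ (t : ℝ) : ℝ := ∫ s in Set.Ioi t, (Real.sqrt (2 * π))⁻¹ * Real.exp (-(s ^ 2) / 2)

/-- Power spectrum of the Gauss-Markov source. -/
def S (a σ w : ℝ) : ℝ := σ ^ 2 / (1 + a ^ 2 - 2 * a * Real.cos w)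

/-- The limiting reverse waterfilling equation relating distortion `d` and water level `θ`. -/
def waterEq (a σ θ d : ℝ) : Prop :=
  d = (1 / (2 * π)) * ∫ w in Set.Icc (-π) π, min θ (S a σ w)

/-- The rate-distortion function `R_U(d)`, parametrized by the water level `θ` matched to `d`. -/
def RU (a σ θ : ℝ) : ℝ :=
  (1 / (2 * π)) * ∫ w in Set.Icc (-π) π, max 0 ((1 / 2) * Real.log (S a σ w / θ))

/-- The dispersion `V_U(d)`, parametrized by the water level `θ` matched to `d`. -/
def VU (a σ θ : ℝ) : ℝ :=
  (1 / (4 * π)) * ∫ w in Set.Icc (-π) π, min 1 ((S a σ w / θ) ^ 2)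

/-- The lower bidiagonal matrix `A` with `1` on the diagonal, `-a` on the first subdiagonal. -/
def Amat (a : ℝ) (n : ℕ) : Matrix (Fin n) (Fin n) ℝ :=
  Matrix.of fun i j => if i = j then 1 else if (i : ℕ) = (j : ℕ) + 1 then -a else 0

/-- `μv` is the nondecreasing enumeration of the eigenvalues (with multiplicity) of the
real symmetric matrix `M`: it is monotone and `M = P D Pᵀ` for some orthogonal `P`. -/
def IsEigs {n : ℕ} (μv : Fin n → ℝ) (M : Matrix (Fin n) (Fin n) ℝ) : Prop :=
  Monotone μv ∧ ∃ P : Matrix (Fin n) (Fin n) ℝ,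
    P * Pᵀ = 1 ∧ Pᵀ * P = 1 ∧ M = P * Matrix.diagonal μv * Pᵀ

/-- The `i`-th entry of `u` (0-based), or `0` if out of range. -/
def entry {n : ℕ} (u : Fin n → ℝ) (i : ℕ) : ℝ := if h : i < n then u ⟨i, h⟩ else 0

/-- Maximum likelihood estimator `â(u) = (∑_{i=1}^{n-1} u_i u_{i+1}) / (∑_{i=1}^{n-1} u_i²)`. -/
def mle {n : ℕ} (u : Fin n → ℝ) : ℝ :=
  (∑ i ∈ Finset.range (n - 1), entry u i * entry u (i + 1)) /
    ∑ i ∈ Finset.range (n - 1), entry u i ^ 2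

/-- The `d`-tilted information expression, parametrized by a water level `θ`,
per-coordinate variances `sv`, evaluated at the point `x`. -/
def Jtilt {n : ℕ} (θ : ℝ) (sv : Fin n → ℝ) (x : Fin n → ℝ) : ℝ :=
  ∑ i, ((min θ (sv i) / (2 * θ)) * ((x i) ^ 2 / sv i - 1)
        + (1 / 2) * Real.log (max θ (sv i) / θ))

end GM

section
namespace GMX


/-- `f` is bounded measurable with a uniform second-order Taylor expansion. -/
def Tay (f : ℝ → ℝ) (K : ℝ) : Prop :=
  Measurable f ∧ (∃ b, ∀ x, |f x| ≤ b) ∧ ∃ f1 f2 : ℝ → ℝ, ∀ x h,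
    |f (x + h) - f x - f1 x * h - f2 x * h ^ 2 / 2| ≤ K * |h| ^ 3

lemma Tay.shift {f : ℝ → ℝ} {K : ℝ} (hf : Tay f K) (y : ℝ) : Tay (fun x => f (x + y)) K := by
  obtain ⟨hm, ⟨b, hb⟩, f1, f2, h⟩ := hf
  refine ⟨hm.comp (measurable_id.add_const y), ⟨b, fun x => hb _⟩, fun x => f1 (x + y),
    fun x => f2 (x + y), fun x k => ?_⟩
  have := h (x + y) k
  rwa [show x + y + k = x + k + y by ring] at this

lemma Tay.integrable {f : ℝ → ℝ} {K : ℝ} (hf : Tay f K) {α : Type*} [MeasurableSpace α]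
    (μ : Measure α) [IsFiniteMeasure μ] {g : α → ℝ} (hg : Measurable g) :
    Integrable (fun x => f (g x)) μ := by
  obtain ⟨hm, ⟨b, hb⟩, _⟩ := hf
  exact Integrable.of_bound (hm.comp hg).aestronglyMeasurable b
    (ae_of_all _ fun x => by simpa using hb _)

lemma int1 {ν : Measure ℝ} [IsProbabilityMeasure ν] (h3 : Integrable (fun y => |y| ^ 3) ν) :
    Integrable (fun y : ℝ => y) ν := by
  refine ((integrable_const (1:ℝ)).add h3).mono' (by fun_prop) (ae_of_all _ fun y => ?_)
  simp only [Real.norm_eq_abs, Pi.add_apply]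
  nlinarith [abs_nonneg y, sq_nonneg (|y| - 1), mul_nonneg (abs_nonneg y) (sq_nonneg (|y| - 1))]

lemma int2 {ν : Measure ℝ} [IsProbabilityMeasure ν] (h3 : Integrable (fun y => |y| ^ 3) ν) :
    Integrable (fun y : ℝ => y ^ 2) ν := by
  refine ((integrable_const (1:ℝ)).add h3).mono' (by fun_prop) (ae_of_all _ fun y => ?_)
  simp only [Real.norm_eq_abs, Pi.add_apply, abs_pow]
  nlinarith [abs_nonneg y, sq_nonneg (|y| - 1), mul_nonneg (abs_nonneg y) (sq_nonneg (|y| - 1))]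

lemma one_step {f f1 f2 : ℝ → ℝ} {K : ℝ} (hf : Tay f K)
    (h : ∀ x h, |f (x + h) - f x - f1 x * h - f2 x * h ^ 2 / 2| ≤ K * |h| ^ 3)
    {ν : Measure ℝ} [IsProbabilityMeasure ν] (h3 : Integrable (fun y => |y| ^ 3) ν)
    {v : ℝ} (h1 : ∫ y, y ∂ν = 0) (h2 : ∫ y, y ^ 2 ∂ν = v) (x : ℝ) :
    |∫ y, f (x + y) ∂ν - f x - f2 x * v / 2| ≤ K * ∫ y, |y| ^ 3 ∂ν := by
  have i0 : Integrable (fun y => f (x + y)) ν := hf.integrable ν (by fun_prop)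
  have i1 := int1 h3
  have i2 := int2 h3
  have e : ∫ y, f (x + y) ∂ν - f x - f2 x * v / 2
      = ∫ y, (f (x + y) - f x - f1 x * y - f2 x * y ^ 2 / 2) ∂ν := by
    have j0 : Integrable (fun y => f (x + y) - f x) ν := i0.sub (integrable_const _)
    have j1 : Integrable (fun y => f1 x * y) ν := i1.const_mul _
    have j2 : Integrable (fun y => f2 x * y ^ 2 / 2) ν := (i2.const_mul _).div_const _
    have j3 : Integrable (fun y => f (x + y) - f x - f1 x * y) ν := j0.sub j1
    rw [integral_sub j3 j2, integral_sub j0 j1,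
      integral_sub i0 (integrable_const _), integral_const_mul, integral_div, integral_const_mul, h1, h2]
    simp
  rw [e, ← integral_const_mul]
  refine (abs_integral_le_integral_abs).trans (integral_mono_of_nonneg (ae_of_all _ fun y => abs_nonneg _)
    (h3.const_mul _) (ae_of_all _ fun y => h x y))

def c3 : ℝ := ∫ y, |y| ^ 3 ∂(gaussianReal 0 1)

lemma gint (v : ℝ≥0) (k : ℕ) : Integrable (fun y : ℝ => |y| ^ k) (gaussianReal 0 v) := by
  simpa using (memLp_id_gaussianReal (μ := 0) (v := v) k).integrable_norm_pow'

lemma g3 (v : ℝ≥0) : ∫ y, |y| ^ 3 ∂(gaussianReal 0 v) = c3 * Real.sqrt v ^ 3 := by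
  have : gaussianReal 0 v = (gaussianReal 0 1).map (fun x => Real.sqrt v * x) := by
    rw [gaussianReal_map_const_mul]
    congr 1
    · simp
    · ext; simp
  rw [this, integral_map (by fun_prop) (by fun_prop)]
  simp_rw [abs_mul, mul_pow, abs_of_nonneg (Real.sqrt_nonneg _)]
  rw [integral_const_mul, c3, mul_comm]

lemma g1 (v : ℝ≥0) : ∫ y, y ∂(gaussianReal 0 v) = 0 := integral_id_gaussianReal

lemma g2 (v : ℝ≥0) : ∫ y, y ^ 2 ∂(gaussianReal 0 v) = v := by
  have := variance_fun_id_gaussianReal (μ := 0) (v := v)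
  rw [variance_of_integral_eq_zero (by fun_prop) (g1 v)] at this
  exact this

lemma step2 {f : ℝ → ℝ} {K : ℝ} (hf : Tay f K)
    {ν : Measure ℝ} [IsProbabilityMeasure ν] (h3 : Integrable (fun y => |y| ^ 3) ν)
    {v : ℝ≥0} (h1 : ∫ y, y ∂ν = 0) (h2 : ∫ y, y ^ 2 ∂ν = v) (x : ℝ) :
    |∫ y, f (x + y) ∂ν - ∫ y, f (x + y) ∂(gaussianReal 0 v)|
      ≤ K * (∫ y, |y| ^ 3 ∂ν + c3 * Real.sqrt v ^ 3) := by
  obtain ⟨f1, f2, h⟩ := hf.2.2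
  have a := one_step hf h h3 h1 h2 x
  have b := one_step hf h (gint v 3) (g1 v) (g2 v) x
  rw [g3] at b
  rw [abs_le] at *
  constructor <;> linarith

theorem lindeberg {Ω ι : Type*} [MeasurableSpace Ω] {P : Measure Ω} [IsProbabilityMeasure P]
    {X : ι → Ω → ℝ} (hX : ∀ i, Measurable (X i)) (hind : iIndepFun X P) (v : ι → ℝ≥0)
    (h1 : ∀ i, ∫ ω, X i ω ∂P = 0) (h2 : ∀ i, ∫ ω, X i ω ^ 2 ∂P = v i)
    (h3 : ∀ i, Integrable (fun ω => |X i ω| ^ 3) P) {K : ℝ} (s : Finset ι) :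
    ∀ f : ℝ → ℝ, Tay f K →
    |∫ ω, f (∑ i ∈ s, X i ω) ∂P - ∫ x, f x ∂(gaussianReal 0 (∑ i ∈ s, v i))|
      ≤ K * ∑ i ∈ s, (∫ ω, |X i ω| ^ 3 ∂P + c3 * Real.sqrt (v i) ^ 3) := by
  classical
  induction s using Finset.induction_on with
  | empty => intro f hf; simp
  | insert j s hj ih =>
    intro f hf
    set Sm : Ω → ℝ := fun ω => ∑ i ∈ s, X i ω with hSm
    have mS : Measurable Sm := Finset.measurable_sum s fun i _ => hX i
    have hI : IndepFun Sm (X j) P := by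
      have := iIndepFun.indepFun_finsetSum_of_notMem hind hX hj
      convert this using 1
      ext ω; simp [hSm]
    have hprod := (indepFun_iff_map_prod_eq_prod_map_map mS.aemeasurable (hX j).aemeasurable).1 hI
    set μS := P.map Sm
    set ν := P.map (X j)
    have : IsProbabilityMeasure μS := Measure.isProbabilityMeasure_map mS.aemeasurable
    have : IsProbabilityMeasure ν := Measure.isProbabilityMeasure_map (hX j).aemeasurable
    have n1 : ∫ y, y ∂ν = 0 := by
      rw [integral_map (hX j).aemeasurable (by fun_prop)]; exact h1 j
    have n2 : ∫ y, y ^ 2 ∂ν = v j := by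
      rw [integral_map (hX j).aemeasurable (by fun_prop)]; exact h2 j
    have n3 : ∫ y, |y| ^ 3 ∂ν = ∫ ω, |X j ω| ^ 3 ∂P := by
      rw [integral_map (hX j).aemeasurable (by fun_prop)]
    have n3' : Integrable (fun y => |y| ^ 3) ν := by
      rw [integrable_map_measure (by fun_prop) (hX j).aemeasurable]; exact h3 j
    have hfm := hf.1
    have E1 : ∫ ω, f (∑ i ∈ insert j s, X i ω) ∂P = ∫ x, ∫ y, f (x + y) ∂ν ∂μS := by
      rw [← integral_prod (f := fun z : ℝ × ℝ => f (z.1 + z.2)) (hf.integrable _ (by fun_prop)),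
        ← hprod, integral_map (by fun_prop)
          (by exact (hfm.comp (measurable_fst.add measurable_snd)).aestronglyMeasurable)]
      refine integral_congr_ae (ae_of_all _ fun ω => ?_)
      simp [Finset.sum_insert hj, hSm, add_comm]
    have E2 : ∫ x, f x ∂(gaussianReal 0 (∑ i ∈ insert j s, v i))
        = ∫ y, ∫ x, f (x + y) ∂(gaussianReal 0 (∑ i ∈ s, v i)) ∂(gaussianReal 0 (v j)) := by
      rw [Finset.sum_insert hj, add_comm]
      have := gaussianReal_conv_gaussianReal (m₁ := 0) (m₂ := 0) (v₁ := ∑ i ∈ s, v i) (v₂ := v j)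
      rw [add_zero] at this
      rw [← this, Measure.conv, integral_map (by fun_prop) (by fun_prop),
        integral_prod_symm _ (hf.integrable _ (by fun_prop))]
    have E3 : ∫ x, ∫ y, f (x + y) ∂(gaussianReal 0 (v j)) ∂μS
        = ∫ y, ∫ x, f (x + y) ∂μS ∂(gaussianReal 0 (v j)) :=
      integral_integral_swap (f := fun x y => f (x + y))
        (hf.integrable (μS.prod (gaussianReal 0 (v j))) (g := fun z : ℝ × ℝ => z.1 + z.2) (by fun_prop))
    have key : ∀ (m m' : Measure ℝ) [IsProbabilityMeasure m] [IsProbabilityMeasure m'],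
        Integrable (fun x => ∫ y, f (x + y) ∂m') m := by
      intro m m' _ _
      exact (hf.integrable (m.prod m') (g := fun z : ℝ × ℝ => z.1 + z.2) (by fun_prop)).integral_prod_left
    have key' : ∀ (m m' : Measure ℝ) [IsProbabilityMeasure m] [IsProbabilityMeasure m'],
        Integrable (fun y => ∫ x, f (x + y) ∂m') m := by
      intro m m' _ _
      have := key m m'
      simpa only [add_comm] using this
    have B1 : |∫ x, ∫ y, f (x + y) ∂ν ∂μS - ∫ x, ∫ y, f (x + y) ∂(gaussianReal 0 (v j)) ∂μS|
        ≤ K * (∫ ω, |X j ω| ^ 3 ∂P + c3 * Real.sqrt (v j) ^ 3) := by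
      rw [← integral_sub (key _ _) (key _ _), ← n3]
      refine (abs_integral_le_integral_abs).trans ?_
      refine (integral_mono_of_nonneg (ae_of_all _ fun y => abs_nonneg _) (integrable_const _)
        (ae_of_all _ fun x => step2 hf n3' n1 n2 x)).trans ?_
      simp
    have B2 : |∫ y, ∫ x, f (x + y) ∂μS ∂(gaussianReal 0 (v j)) -
        ∫ y, ∫ x, f (x + y) ∂(gaussianReal 0 (∑ i ∈ s, v i)) ∂(gaussianReal 0 (v j))|
        ≤ K * ∑ i ∈ s, (∫ ω, |X i ω| ^ 3 ∂P + c3 * Real.sqrt (v i) ^ 3) := by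
      rw [← integral_sub (key' _ _) (key' _ _)]
      refine (abs_integral_le_integral_abs).trans ?_
      refine (integral_mono_of_nonneg (ae_of_all _ fun y => abs_nonneg _)
        (integrable_const (K * ∑ i ∈ s, (∫ ω, |X i ω| ^ 3 ∂P + c3 * Real.sqrt (v i) ^ 3)))
        (ae_of_all _ fun y => ?_)).trans ?_
      · have := ih _ (hf.shift y)
        show |_| ≤ _
        rw [show μS = P.map Sm from rfl, integral_map mS.aemeasurable
          (by exact (hfm.comp (measurable_id.add_const y)).aestronglyMeasurable)]
        exact this
      · simp
    rw [E1, E2, Finset.sum_insert hj, mul_add]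
    rw [E3] at B1
    rw [abs_le] at *
    constructor <;> linarith

end GMX
end

section
namespace GMX


lemma st_deriv_bdd : ∃ K : ℝ, ∀ x, |iteratedDeriv 3 smoothTransition x| ≤ K := by
  have hc : Continuous (iteratedDeriv 3 smoothTransition) :=
    ContDiff.continuous_iteratedDeriv' 3 smoothTransition.contDiff
  obtain ⟨K, hK⟩ := (isCompact_Icc (a := (0:ℝ)) (b := 1)).exists_bound_of_continuousOn hc.continuousOn
  refine ⟨max K 0, fun x => ?_⟩
  by_cases h : x ∈ Set.Icc (0:ℝ) 1
  · exact (hK x h).trans (le_max_left _ _)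
  · have h0 : iteratedDeriv 3 smoothTransition x = 0 := by
      rw [Set.mem_Icc, not_and_or, not_le, not_le] at h
      rcases h with h | h
      · have : smoothTransition =ᶠ[nhds x] fun _ => (0:ℝ) := by
          filter_upwards [Iio_mem_nhds h] with y hy
          exact smoothTransition.zero_of_nonpos (le_of_lt hy)
        rw [Filter.EventuallyEq.iteratedDeriv_eq 3 this]; simp
      · have : smoothTransition =ᶠ[nhds x] fun _ => (1:ℝ) := by
          filter_upwards [Ioi_mem_nhds h] with y hy
          exact smoothTransition.one_of_one_le (le_of_lt hy)
        rw [Filter.EventuallyEq.iteratedDeriv_eq 3 this]; simp [iteratedDeriv_const]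
    rw [h0]; simp

lemma st_tay : ∃ K : ℝ, 0 < K ∧ Tay smoothTransition K := by
  obtain ⟨K, hK⟩ := st_deriv_bdd
  refine ⟨|K| + 1, by positivity, smoothTransition.continuous.measurable, ⟨1, fun x => ?_⟩,
    fun x => iteratedDeriv 1 smoothTransition x, fun x => iteratedDeriv 2 smoothTransition x, fun x h => ?_⟩
  · rw [abs_of_nonneg (smoothTransition.nonneg x)]; exact smoothTransition.le_one x
  · by_cases hh : h = 0
    · simp [hh]
    have hne : x ≠ x + h := by intro h'; exact hh (by linarith)
    obtain ⟨x', _, h2⟩ := taylor_mean_remainder_lagrange_iteratedDeriv (f := smoothTransition) (n := 2) hne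
      (smoothTransition.contDiff.contDiffOn)
    have hu : UniqueDiffOn ℝ (Set.uIcc x (x+h)) := uniqueDiffOn_uIcc hne
    have e1 : iteratedDerivWithin 1 smoothTransition (Set.uIcc x (x+h)) x = iteratedDeriv 1 smoothTransition x :=
      iteratedDerivWithin_eq_iteratedDeriv hu smoothTransition.contDiffAt Set.left_mem_uIcc
    have e2 : iteratedDerivWithin 2 smoothTransition (Set.uIcc x (x+h)) x = iteratedDeriv 2 smoothTransition x :=
      iteratedDerivWithin_eq_iteratedDeriv hu smoothTransition.contDiffAt Set.left_mem_uIcc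
    rw [taylorWithinEval_succ, taylorWithinEval_succ, taylor_within_zero_eval] at h2
    simp only [zero_add, e1, Nat.reduceAdd, e2] at h2
    simp only [Nat.factorial, add_sub_cancel_left, smul_eq_mul] at h2
    have h3 : smoothTransition (x + h) - smoothTransition x - iteratedDeriv 1 smoothTransition x * h -
      iteratedDeriv 2 smoothTransition x * h ^ 2 / 2 = iteratedDeriv 3 smoothTransition x' * h ^ 3 / 6 := by
      norm_num at h2
      rw [iteratedDeriv_one]
      linear_combination h2
    rw [h3, abs_div, abs_mul, abs_pow]
    have := hK x'
    have h6 : |iteratedDeriv 3 smoothTransition x'| ≤ |K| + 1 := this.trans (by linarith [le_abs_self K])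
    have h7 : |(6:ℝ)| = 6 := by norm_num
    rw [h7, div_le_iff₀ (by norm_num)]
    have : 0 ≤ |h|^3 := by positivity
    have h8 := mul_le_mul_of_nonneg_right h6 this
    nlinarith [abs_nonneg K]

def Kst : ℝ := st_tay.choose
lemma Kst_pos : 0 < Kst := st_tay.choose_spec.1

def stp (b τ : ℝ) (x : ℝ) : ℝ := smoothTransition ((x - b) / τ)

lemma stp_tay (b : ℝ) {τ : ℝ} (hτ : 0 < τ) : Tay (stp b τ) (Kst / τ ^ 3) := by
  obtain ⟨hm, ⟨c, hc⟩, f1, f2, h⟩ := st_tay.choose_spec.2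
  refine ⟨hm.comp (by fun_prop), ⟨c, fun x => hc _⟩, fun x => f1 ((x - b)/τ) / τ,
    fun x => f2 ((x-b)/τ) / τ^2, fun x k => ?_⟩
  have := h ((x-b)/τ) (k/τ)
  rw [abs_div, abs_of_pos hτ] at this
  unfold stp
  convert this using 1
  · congr 1
    rw [show (x + k - b)/τ = (x-b)/τ + k/τ by ring]
    ring
  · unfold Kst; ring

lemma Tay.sub {f g : ℝ → ℝ} {K L : ℝ} (hf : Tay f K) (hg : Tay g L) :
    Tay (fun x => f x - g x) (K + L) := by
  obtain ⟨hm, ⟨c, hc⟩, f1, f2, h⟩ := hf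
  obtain ⟨hm', ⟨c', hc'⟩, g1, g2, h'⟩ := hg
  refine ⟨hm.sub hm', ⟨c + c', fun x => (abs_sub _ _).trans (add_le_add (hc x) (hc' x))⟩,
    fun x => f1 x - g1 x, fun x => f2 x - g2 x, fun x k => ?_⟩
  have a := h x k
  have b := h' x k
  rw [abs_le] at *
  constructor <;> nlinarith

variable {Ω ι : Type*} [MeasurableSpace Ω] {P : Measure Ω} [IsProbabilityMeasure P]

lemma ind_le (A : Set Ω) (hA : MeasurableSet A) {g : Ω → ℝ} (hg : Integrable g P) (h0 : ∀ ω, 0 ≤ g ω)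
    (h : ∀ ω ∈ A, 1 ≤ g ω) : P.real A ≤ ∫ ω, g ω ∂P := by
  rw [← integral_indicator_one hA]
  refine integral_mono ((integrable_const (1:ℝ)).indicator hA) hg fun ω => ?_
  by_cases hω : ω ∈ A
  · simpa [hω] using h ω hω
  · simpa [hω] using h0 ω

lemma le_ind (A : Set Ω) (hA : MeasurableSet A) {g : Ω → ℝ} (hg : Integrable g P) (h0 : ∀ ω, g ω ≤ 1)
    (h : ∀ ω, ω ∉ A → g ω ≤ 0) : ∫ ω, g ω ∂P ≤ P.real A := by
  rw [← integral_indicator_one hA]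
  refine integral_mono hg ((integrable_const (1:ℝ)).indicator hA) fun ω => ?_
  by_cases hω : ω ∈ A
  · simpa [hω] using h0 ω
  · simpa [hω] using h ω hω

theorem tail_bound 
    {X : ι → Ω → ℝ} (hX : ∀ i, Measurable (X i)) (hind : iIndepFun X P) (v : ι → ℝ≥0)
    (h1 : ∀ i, ∫ ω, X i ω ∂P = 0) (h2 : ∀ i, ∫ ω, X i ω ^ 2 ∂P = v i)
    (h3 : ∀ i, Integrable (fun ω => |X i ω| ^ 3) P) (s : Finset ι) (b : ℝ) {τ : ℝ} (hτ : 0 < τ) :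
    P.real {ω | b + τ ≤ ∑ i ∈ s, X i ω} ≤ (gaussianReal 0 (∑ i ∈ s, v i)).real (Set.Ioi b)
      + Kst / τ ^ 3 * ∑ i ∈ s, (∫ ω, |X i ω| ^ 3 ∂P + c3 * Real.sqrt (v i) ^ 3) := by
  have L := lindeberg hX hind v h1 h2 h3 s _ (stp_tay b hτ)
  have mS : Measurable fun ω => ∑ i ∈ s, X i ω := Finset.measurable_sum s fun i _ => hX i
  have A1 : P.real {ω | b + τ ≤ ∑ i ∈ s, X i ω} ≤ ∫ ω, stp b τ (∑ i ∈ s, X i ω) ∂P := by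
    refine ind_le _ (measurableSet_le measurable_const mS) ((stp_tay b hτ).integrable _ mS)
      (fun ω => smoothTransition.nonneg _) fun ω hω => ?_
    have hω : b + τ ≤ ∑ i ∈ s, X i ω := hω
    unfold stp
    rw [smoothTransition.one_of_one_le]
    rw [le_div_iff₀ hτ]; linarith
  have A2 : ∫ x, stp b τ x ∂(gaussianReal 0 (∑ i ∈ s, v i)) ≤ (gaussianReal 0 (∑ i ∈ s, v i)).real (Set.Ioi b) := by
    refine le_ind _ measurableSet_Ioi ((stp_tay b hτ).integrable _ measurable_id)
      (fun ω => smoothTransition.le_one _) fun x hx => ?_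
    have hx : x ≤ b := by simpa using hx
    unfold stp
    rw [smoothTransition.zero_of_nonpos]
    exact div_nonpos_of_nonpos_of_nonneg (by linarith) hτ.le
  rw [abs_le] at L
  linarith [L.2]

theorem window_bound 
    {X : ι → Ω → ℝ} (hX : ∀ i, Measurable (X i)) (hind : iIndepFun X P) (v : ι → ℝ≥0)
    (h1 : ∀ i, ∫ ω, X i ω ∂P = 0) (h2 : ∀ i, ∫ ω, X i ω ^ 2 ∂P = v i)
    (h3 : ∀ i, Integrable (fun ω => |X i ω| ^ 3) P) (s : Finset ι) {τ : ℝ} (hτ : 0 < τ) :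
    (gaussianReal 0 (∑ i ∈ s, v i)).real (Set.Icc (-τ) τ)
      - 2 * Kst / τ ^ 3 * ∑ i ∈ s, (∫ ω, |X i ω| ^ 3 ∂P + c3 * Real.sqrt (v i) ^ 3) ≤ 
    P.real {ω | |∑ i ∈ s, X i ω| ≤ 2 * τ} := by
  have T := (stp_tay (-(2*τ)) hτ).sub (stp_tay τ hτ)
  have L := lindeberg hX hind v h1 h2 h3 s _ T
  have mS : Measurable fun ω => ∑ i ∈ s, X i ω := Finset.measurable_sum s fun i _ => hX i
  have A1 : ∫ ω, (stp (-(2*τ)) τ (∑ i ∈ s, X i ω) - stp τ τ (∑ i ∈ s, X i ω)) ∂P ≤ 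
      P.real {ω | |∑ i ∈ s, X i ω| ≤ 2 * τ} := by
    refine le_ind _ (measurableSet_le (by fun_prop) measurable_const) (T.integrable _ mS)
      (fun ω => ?_) fun ω hω => ?_
    · unfold stp
      have := smoothTransition.le_one ((∑ i ∈ s, X i ω - -(2 * τ)) / τ)
      have := smoothTransition.nonneg ((∑ i ∈ s, X i ω - τ) / τ)
      linarith
    · have hω : 2 * τ < |∑ i ∈ s, X i ω| := by simpa using hω
      unfold stp
      rcases lt_abs.1 hω with h | h
      · rw [smoothTransition.one_of_one_le (x := (∑ i ∈ s, X i ω - τ) / τ)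
          (by rw [le_div_iff₀ hτ]; linarith)]
        linarith [smoothTransition.le_one ((∑ i ∈ s, X i ω - -(2 * τ)) / τ)]
      · rw [smoothTransition.zero_of_nonpos (x := (∑ i ∈ s, X i ω - -(2 * τ)) / τ)
          (div_nonpos_of_nonpos_of_nonneg (by linarith) hτ.le)]
        linarith [smoothTransition.nonneg ((∑ i ∈ s, X i ω - τ) / τ)]
  have A2 : (gaussianReal 0 (∑ i ∈ s, v i)).real (Set.Icc (-τ) τ) ≤ 
      ∫ x, (stp (-(2*τ)) τ x - stp τ τ x) ∂(gaussianReal 0 (∑ i ∈ s, v i)) := by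
    refine ind_le _ measurableSet_Icc (T.integrable _ measurable_id) (fun x => ?_) fun x hx => ?_
    · unfold stp
      have : (x - τ)/τ ≤ (x - -(2*τ))/τ := by gcongr; linarith
      linarith [smoothTransition.monotone this]
    · unfold stp
      rw [smoothTransition.one_of_one_le (x := (x - -(2 * τ)) / τ) (by rw [le_div_iff₀ hτ]; linarith [hx.1]),
        smoothTransition.zero_of_nonpos (x := (x - τ)/τ)
          (div_nonpos_of_nonpos_of_nonneg (by linarith [hx.2]) hτ.le)]
      norm_num
  rw [abs_le] at L
  have e : 2 * Kst / τ ^ 3 = Kst/τ^3 + Kst/τ^3 := by ring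
  rw [e]
  linarith [L.1]

end GMX
end

section
namespace GMX


lemma gmap (v : ℝ≥0) : gaussianReal 0 v = (gaussianReal 0 1).map (fun x => Real.sqrt v * x) := by
  rw [gaussianReal_map_const_mul]
  congr 1
  · simp
  · ext; simp

lemma pdf1 (x : ℝ) : gaussianPDFReal 0 1 x = (Real.sqrt (2 * π))⁻¹ * Real.exp (-(x ^ 2) / 2) := by
  simp [gaussianPDFReal]

lemma greal (A : Set ℝ) : (gaussianReal 0 1).real A = 
    ∫ s in A, (Real.sqrt (2 * π))⁻¹ * Real.exp (-(s ^ 2) / 2) := by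
  rw [Measure.real, gaussianReal_apply_eq_integral 0 one_ne_zero,
    ENNReal.toReal_ofReal (integral_nonneg fun x => gaussianPDFReal_nonneg _ _ _)]
  simp_rw [pdf1]

lemma gint1 : Integrable (fun s : ℝ => (Real.sqrt (2 * π))⁻¹ * Real.exp (-(s ^ 2) / 2)) := by
  have := integrable_gaussianPDFReal 0 1
  exact this.congr (ae_of_all _ fun x => pdf1 x)

lemma sq2pi : Real.sqrt (2 * π) ≤ 3 := by
  rw [Real.sqrt_le_left (by norm_num)]
  linarith [pi_lt_four]

lemma icc_lower (c L : ℝ) (lo hi : ℝ) (hlh : lo ≤ hi) (hc : ∀ x ∈ Set.Icc lo hi, |x| ≤ L) :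
    (hi - lo) * ((Real.sqrt (2 * π))⁻¹ * Real.exp (-(L ^ 2) / 2)) ≤ (gaussianReal 0 1).real (Set.Icc lo hi) := by
  rw [greal]
  have := setIntegral_mono_on (μ := volume) (s := Set.Icc lo hi) 
    (f := fun _ => (Real.sqrt (2 * π))⁻¹ * Real.exp (-(L ^ 2) / 2)) 
    (integrableOn_const (by simp)) gint1.integrableOn measurableSet_Icc (fun x hx => by
      have h1 := hc x hx
      have : x ^ 2 ≤ L ^ 2 := by
        rw [← sq_abs x]; exact pow_le_pow_left₀ (abs_nonneg _) h1 2
      gcongr)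
  refine le_trans (le_of_eq ?_) this
  simp [hlh]

lemma gsmall {v : ℝ≥0} {V r : ℝ} (hV : 0 < V) (hv : v ≤ V) (hr : 0 < r) (hrV : r ≤ Real.sqrt V) :
    r / (4 * Real.sqrt V) ≤ (gaussianReal 0 v).real (Set.Icc (-r) r) := by
  have hsV : 0 < Real.sqrt V := Real.sqrt_pos.2 hV
  have h1 : (gaussianReal 0 1).real (Set.Icc (-(r / Real.sqrt V)) (r / Real.sqrt V)) ≤ 
      (gaussianReal 0 v).real (Set.Icc (-r) r) := by
    rw [gmap v, map_measureReal_apply (by fun_prop) measurableSet_Icc]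
    refine measureReal_mono fun x hx => ?_
    have : |x| ≤ r / Real.sqrt V := abs_le.2 hx
    have hs : Real.sqrt v ≤ Real.sqrt V := Real.sqrt_le_sqrt hv
    show _ ∈ Set.Icc _ _
    rw [Set.mem_Icc, ← abs_le, abs_mul, abs_of_nonneg (Real.sqrt_nonneg _)]
    calc _ ≤ Real.sqrt V * (r / Real.sqrt V) := by gcongr
      _ = r := by field_simp
  refine le_trans ?_ h1
  have hu : r / Real.sqrt V ≤ 1 := (div_le_one hsV).2 hrV
  have hu0 : 0 < r / Real.sqrt V := by positivity
  refine le_trans ?_ (icc_lower 0 1 _ _ (by linarith) (fun x hx => (abs_le.2 hx).trans hu))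
  have e1 : (1:ℝ)/2 ≤ Real.exp (-(1 ^ 2) / 2) := by
    have := Real.add_one_le_exp (-(1 ^ 2) / 2 : ℝ); norm_num at this ⊢; linarith
  have e2 : (1:ℝ)/3 ≤ (Real.sqrt (2 * π))⁻¹ := by
    rw [one_div]; exact inv_anti₀ (by positivity) sq2pi
  have e3 : (1:ℝ)/6 ≤ (Real.sqrt (2 * π))⁻¹ * Real.exp (-(1 ^ 2) / 2) := by
    calc (1:ℝ)/6 = 1/3 * (1/2) := by norm_num
      _ ≤ _ := by gcongr
  calc r / (4 * Real.sqrt V) = (r / Real.sqrt V) * (1/4) := by field_simp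
    _ ≤ (r / Real.sqrt V) * 2 * (1/6) := by nlinarith
    _ ≤ _ := by
      rw [show r / √V - -(r / √V) = r / √V * 2 by ring]
      gcongr

lemma gtail {v : ℝ≥0} (hv : 0 < v) (b : ℝ) : 
    (gaussianReal 0 v).real (Set.Ioi b) = GM.gaussQ (b / Real.sqrt v) := by
  have hs : 0 < Real.sqrt v := Real.sqrt_pos.2 (by exact_mod_cast hv)
  rw [gmap v, map_measureReal_apply (by fun_prop) measurableSet_Ioi, GM.gaussQ, ← greal]
  congr 1
  ext x
  simp [div_lt_iff₀ hs, mul_comm]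

def phim (q : ℝ) : ℝ := (Real.sqrt (2 * π))⁻¹ * Real.exp (-((|q| + 1) ^ 2) / 2)
lemma phim_pos (q : ℝ) : 0 < phim q := by unfold phim; positivity

lemma gaussQ_anti : Antitone GM.gaussQ := by
  intro x y h
  unfold GM.gaussQ
  rw [← greal, ← greal]
  exact measureReal_mono (Set.Ioi_subset_Ioi h)

lemma qgain (q : ℝ) {η : ℝ} (h0 : 0 ≤ η) (h1 : η ≤ 1) :
    GM.gaussQ (q + η) ≤ GM.gaussQ q - η * phim q := by
  unfold GM.gaussQ
  rw [← greal, ← greal]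
  have h := icc_lower 0 (|q| + 1) q (q + η) (by linarith) (fun x hx => by
    have := abs_le.1 (le_refl |q|)
    rw [abs_le]; constructor <;> linarith [hx.1, hx.2, le_abs_self q, neg_abs_le q])
  have hu : (gaussianReal 0 1).real (Set.Icc q (q+η)) + (gaussianReal 0 1).real (Set.Ioi (q+η)) 
      = (gaussianReal 0 1).real (Set.Ioi q) := by
    rw [← measureReal_union _ measurableSet_Ioi, Set.Icc_union_Ioi_eq_Ici (by linarith)]
    · have : NullSingletonClass (gaussianReal 0 1) := nullSingletonClass_gaussianReal one_ne_zero
      exact measureReal_congr Ioi_ae_eq_Ici.symm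
    · rw [Set.disjoint_left]; intro x hx hx'; exact absurd hx.2 (not_le.2 hx')
  unfold phim
  rw [show q + η - q = η by ring] at h
  linarith

end GMX
end

section
namespace GMX


lemma pi_wd {n : ℕ} (μ : Fin n → Measure ℝ) [∀ i, IsProbabilityMeasure (μ i)]
    (f : Fin n → ℝ → ℝ≥0∞) (hf : ∀ i, Measurable (f i))
    [∀ i, IsProbabilityMeasure ((μ i).withDensity (f i))] :
    Measure.pi (fun i => (μ i).withDensity (f i))
      = (Measure.pi μ).withDensity (fun h => ∏ i, f i (h i)) := by
  refine Measure.pi_eq fun s hs => ?_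
  rw [withDensity_apply _ (MeasurableSet.univ_pi hs), ← lintegral_indicator (MeasurableSet.univ_pi hs)]
  have e : ∀ h : Fin n → ℝ, (Set.univ.pi s).indicator (fun h => ∏ i, f i (h i)) h
      = ∏ i, (s i).indicator (f i) (h i) := by
    intro h
    by_cases hh : h ∈ Set.univ.pi s
    · rw [Set.indicator_of_mem hh]
      refine Finset.prod_congr rfl fun i _ => ?_
      rw [Set.indicator_of_mem (hh i trivial)]
    · rw [Set.indicator_of_notMem hh]
      simp only [Set.mem_pi, Set.mem_univ, true_implies, not_forall] at hh
      obtain ⟨i, hi⟩ := hh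
      rw [Finset.prod_eq_zero (Finset.mem_univ i)]
      rw [Set.indicator_of_notMem hi]
  have hm : ∀ i, Measurable ((s i).indicator (f i)) := fun i => (hf i).indicator (hs i)
  simp_rw [e]
  rw [lintegral_prod_eq_prod_lintegral_of_indepFun Finset.univ
    (fun i (h : Fin n → ℝ) => (s i).indicator (f i) (h i))
    (iIndepFun_pi (μ := μ) (X := fun i => (s i).indicator (f i)) (fun i => (hm i).aemeasurable))
    (fun i => (hm i).comp (measurable_pi_apply i))]
  refine Finset.prod_congr rfl fun i _ => ?_
  rw [withDensity_apply _ (hs i), ← lintegral_indicator (hs i)]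
  exact ((measurePreserving_eval μ i).lintegral_comp (hm i))

def tl (t ν x : ℝ) : ℝ := 1 / 2 * Real.log (1 + 2 * t * ν) + t * x ^ 2 / (1 + 2 * t * ν)

lemma tilt1 (t ν x : ℝ) (ht : 0 ≤ t) (hν : 0 ≤ ν) :
    (gaussianReal 0 1).withDensity
      (fun h => ENNReal.ofReal (Real.exp (tl t ν x - t * (x - √ν * h) ^ 2)))
    = gaussianReal (2 * t * √ν * x / (1 + 2 * t * ν)) (1 / (1 + 2 * t * ν)).toNNReal := by
  have hp : 0 < 1 + 2 * t * ν := by positivity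
  rw [gaussianReal_of_var_ne_zero _ one_ne_zero, gaussianReal_of_var_ne_zero,
    ← withDensity_mul _ (by fun_prop) (by fun_prop)]
  · congr 1
    ext h
    simp only [Pi.mul_apply, gaussianPDF]
    rw [← ENNReal.ofReal_mul (gaussianPDFReal_nonneg _ _ _)]
    congr 1
    simp only [gaussianPDFReal, tl]
    rw [Real.coe_toNNReal _ (by positivity)]
    obtain ⟨r, hr, rfl⟩ : ∃ r, 0 ≤ r ∧ ν = r ^ 2 := ⟨√ν, by positivity, (Real.sq_sqrt hν).symm⟩
    rw [Real.sqrt_sq hr, show 1 / 2 * Real.log (1 + 2 * t * r ^ 2) = Real.log (√(1 + 2 * t * r ^ 2)) by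
      rw [Real.log_sqrt hp.le]; ring]
    rw [show Real.log (√(1 + 2 * t * r ^ 2)) + t * x ^ 2 / (1 + 2 * t * r ^ 2) - t * (x - r * h) ^ 2
      = Real.log (√(1 + 2 * t * r ^ 2)) + (t * x ^ 2 / (1 + 2 * t * r ^ 2) - t * (x - r * h) ^ 2) by ring,
      Real.exp_add, Real.exp_log (Real.sqrt_pos.2 hp)]
    rw [show 2 * π * (1 / (1 + 2 * t * r ^ 2)) = 2 * π / (1 + 2 * t * r ^ 2) by ring,
      Real.sqrt_div (by positivity), inv_div]
    rw [show √(2 * π * ((1 : ℝ≥0) : ℝ)) = √(2 * π) by simp]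
    rw [show (√(2 * π))⁻¹ * rexp (-(h - 0) ^ 2 / (2 * ((1 : ℝ≥0) : ℝ))) *
      (√(1 + 2 * t * r ^ 2) * rexp (t * x ^ 2 / (1 + 2 * t * r ^ 2) - t * (x - r * h) ^ 2))
      = √(1 + 2 * t * r ^ 2) / √(2 * π) * (rexp (-(h - 0) ^ 2 / (2 * ((1 : ℝ≥0) : ℝ))) *
       rexp (t * x ^ 2 / (1 + 2 * t * r ^ 2) - t * (x - r * h) ^ 2)) by ring, ← Real.exp_add]
    congr 2
    have : (1 + 2 * t * r ^ 2) ≠ 0 := hp.ne'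
    push_cast
    field_simp
    ring
  · simp only [ne_eq, Real.toNNReal_eq_zero, not_le]; positivity

lemma gaff (m : ℝ) (v : ℝ≥0) : gaussianReal m v = (gaussianReal 0 1).map (fun x => m + √v * x) := by
  rw [show (fun x => m + √(v:ℝ) * x) = (fun x => m + x) ∘ (fun x => √(v:ℝ) * x) from rfl,
    ← Measure.map_map (by fun_prop) (by fun_prop), ← gmap, gaussianReal_map_const_add]
  simp

abbrev gam (n : ℕ) : Measure (Fin n → ℝ) := Measure.pi fun _ => gaussianReal 0 1

lemma tilt {n : ℕ} (t B τ : ℝ) (ν x : Fin n → ℝ) (ht : 0 ≤ t) (hν : ∀ i, 0 ≤ ν i) :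
    Real.exp (-(∑ i, tl t (ν i) (x i)) + t * (B - τ)) *
      (gam n).real {g | B - τ ≤ ∑ i, (x i / (1 + 2 * t * ν i) - √(ν i / (1 + 2 * t * ν i)) * g i) ^ 2
        ∧ ∑ i, (x i / (1 + 2 * t * ν i) - √(ν i / (1 + 2 * t * ν i)) * g i) ^ 2 ≤ B}
    ≤ (gam n).real {h | ∑ i, (x i - √(ν i) * h i) ^ 2 ≤ B} := by
  have hp : ∀ i, 0 < 1 + 2 * t * ν i := fun i => by have := hν i; positivity
  let m : Fin n → ℝ := fun i => 2 * t * √(ν i) * x i / (1 + 2 * t * ν i)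
  let v : Fin n → ℝ≥0 := fun i => (1 / (1 + 2 * t * ν i)).toNNReal
  let Qm := Measure.pi (fun i => gaussianReal (m i) (v i))
  let W : Set (Fin n → ℝ) := {h | B - τ ≤ ∑ i, (x i - √(ν i) * h i) ^ 2 ∧ ∑ i, (x i - √(ν i) * h i) ^ 2 ≤ B}
  have hW : MeasurableSet W := by
    have h1 : MeasurableSet {h : Fin n → ℝ | B - τ ≤ ∑ i, (x i - √(ν i) * h i) ^ 2} :=
      measurableSet_le (by fun_prop) (by fun_prop)
    have h2 : MeasurableSet {h : Fin n → ℝ | ∑ i, (x i - √(ν i) * h i) ^ 2 ≤ B} :=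
      measurableSet_le (by fun_prop) (by fun_prop)
    exact h1.inter h2
  have e1 : Qm = (gam n).map (fun g i => m i + √(v i) * g i) := by
    have : (fun i => gaussianReal (m i) (v i)) = fun i => (gaussianReal 0 1).map (fun x => m i + √(v i) * x) :=
      funext fun i => gaff (m i) (v i)
    simp only [Qm]
    rw [this]
    exact (Measure.pi_map_pi (μ := fun _ => gaussianReal 0 1) (f := fun i x => m i + √(v i) * x)
      (fun i => by fun_prop)).symm
  have e2 : (gam n).real {g | B - τ ≤ ∑ i, (x i / (1 + 2 * t * ν i) - √(ν i / (1 + 2 * t * ν i)) * g i) ^ 2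
        ∧ ∑ i, (x i / (1 + 2 * t * ν i) - √(ν i / (1 + 2 * t * ν i)) * g i) ^ 2 ≤ B} = Qm.real W := by
    rw [e1, map_measureReal_apply (by fun_prop) hW]
    congr 1
    ext g
    simp only [W, Set.mem_ofPred_eq, Set.mem_preimage]
    have : ∀ i, (x i / (1 + 2 * t * ν i) - √(ν i / (1 + 2 * t * ν i)) * g i)
        = (x i - √(ν i) * (m i + √(v i) * g i)) := by
      intro i
      have h0 := (hp i).ne'
      simp only [m, v]
      rw [Real.coe_toNNReal _ (by have := hp i; positivity), Real.sqrt_div (hν i), Real.sqrt_div zero_le_one,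
        Real.sqrt_one]
      have : √(ν i) ^ 2 = ν i := Real.sq_sqrt (hν i)
      have h3 : √(1 + 2 * t * ν i) ≠ 0 := (Real.sqrt_pos.2 (hp i)).ne'
      rw [show x i - √(ν i) * (2 * t * √(ν i) * x i / (1 + 2 * t * ν i) + 1 / √(1 + 2 * t * ν i) * g i)
        = x i - (2 * t * √(ν i) ^ 2 * x i / (1 + 2 * t * ν i)) - √(ν i) / √(1 + 2 * t * ν i) * g i by ring, this]
      congr 1
      field_simp
      ring
    simp_rw [this]
  have e3 : Qm = (gam n).withDensity (fun h => ENNReal.ofReal (Real.exp (∑ i, tl t (ν i) (x i)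
      - t * ∑ i, (x i - √(ν i) * h i) ^ 2))) := by
    simp only [Qm]
    have hth : (fun i => gaussianReal (m i) (v i)) = fun i => _ := funext fun i => (tilt1 t (ν i) (x i) ht (hν i)).symm
    have : ∀ i, IsProbabilityMeasure ((gaussianReal 0 1).withDensity
      (fun h => ENNReal.ofReal (Real.exp (tl t (ν i) (x i) - t * (x i - √(ν i) * h) ^ 2)))) := by
      intro i; rw [tilt1 t (ν i) (x i) ht (hν i)]; infer_instance
    rw [hth, pi_wd (fun _ => gaussianReal 0 1) (fun i h => ENNReal.ofReal (Real.exp (tl t (ν i) (x i) - t * (x i - √(ν i) * h) ^ 2)))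
      (fun i => by fun_prop)]
    congr 1
    ext h
    rw [← ENNReal.ofReal_prod_of_nonneg (fun i _ => (Real.exp_pos _).le), ← Real.exp_sum,
      Finset.sum_sub_distrib, Finset.mul_sum]
  have e4 : Qm W ≤ ENNReal.ofReal (Real.exp (∑ i, tl t (ν i) (x i) - t * (B - τ))) * (gam n) W := by
    rw [e3, withDensity_apply _ hW, ← setLIntegral_const]
    refine setLIntegral_mono measurable_const fun h hh => ?_
    apply ENNReal.ofReal_le_ofReal
    apply Real.exp_le_exp.2
    have := mul_le_mul_of_nonneg_left hh.1 ht
    linarith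
  have e5 : Qm.real W ≤ Real.exp (∑ i, tl t (ν i) (x i) - t * (B - τ)) * (gam n).real W := by
    have := ENNReal.toReal_mono (ENNReal.mul_ne_top ENNReal.ofReal_ne_top (measure_ne_top _ _)) e4
    rw [ENNReal.toReal_mul, ENNReal.toReal_ofReal (Real.exp_pos _).le] at this
    exact this
  rw [e2]
  calc _ ≤ Real.exp (-(∑ i, tl t (ν i) (x i)) + t * (B - τ)) * (Real.exp (∑ i, tl t (ν i) (x i) - t * (B - τ)) * (gam n).real W) := by gcongr
    _ = (gam n).real W := by
      rw [← mul_assoc, ← Real.exp_add]; simp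
    _ ≤ _ := measureReal_mono (fun h hh => hh.2)

end GMX
end

section
namespace GMX


lemma pi_int {n : ℕ} (i : Fin n) (f : ℝ → ℝ) (hf : Measurable f) :
    ∫ h, f (h i) ∂(gam n) = ∫ g, f g ∂(gaussianReal 0 1) := by
  have := (measurePreserving_eval (fun _ : Fin n => gaussianReal 0 1) i).map_eq
  conv_rhs => rw [← this]
  rw [integral_map (measurable_pi_apply i).aemeasurable (by exact hf.aestronglyMeasurable)]

lemma pi_integrable {n : ℕ} (i : Fin n) (f : ℝ → ℝ) (hf : Integrable f (gaussianReal 0 1)) :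
    Integrable (fun h : Fin n → ℝ => f (h i)) (gam n) :=
  (measurePreserving_eval (fun _ : Fin n => gaussianReal 0 1) i).integrable_comp_of_integrable hf

lemma int_poly (k : ℕ) : Integrable (fun g : ℝ => (1 + g ^ 2) ^ k) (gaussianReal 0 1) := by
  have : (fun g : ℝ => (1 + g ^ 2) ^ k) = fun g : ℝ => ∑ m ∈ Finset.range (k + 1), |g| ^ (2 * m) * (k.choose m : ℝ) := by
    ext g
    rw [add_comm, add_pow]
    refine Finset.sum_congr rfl fun m _ => ?_
    rw [pow_mul, sq_abs]; simp
  rw [this]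
  exact integrable_finsetSum _ fun m _ => (gint 1 _).mul_const _

def Mk (k : ℕ) : ℝ := ∫ g, (1 + g ^ 2) ^ k ∂(gaussianReal 0 1)

lemma Mk_pos (k : ℕ) : 1 ≤ Mk k := by
  have : ∫ g : ℝ, (1:ℝ) ∂(gaussianReal 0 1) ≤ Mk k := by
    apply integral_mono (integrable_const _) (int_poly k)
    intro g
    exact one_le_pow₀ (by nlinarith [sq_nonneg g])
  simpa using this

/-- quadratic component -/
def qX (b s g : ℝ) : ℝ := (b - s * g) ^ 2 - (b ^ 2 + s ^ 2)

lemma qX_meas (b s : ℝ) : Measurable (qX b s) := by unfold qX; fun_prop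

lemma qX_bound {b s x K0 : ℝ} (hb : |b| ≤ |x|) (hs : 0 ≤ s) (hs2 : s ^ 2 ≤ K0) (g : ℝ) :
    |qX b s g| ≤ (2 * √K0 + K0) * (1 + |x|) * (1 + g ^ 2) := by
  have hK : 0 ≤ K0 := le_trans (sq_nonneg _) hs2
  have hs3 : s ≤ √K0 := Real.le_sqrt_of_sq_le hs2
  have e : qX b s g = - (2 * b * s * g) + s ^ 2 * (g ^ 2 - 1) := by unfold qX; ring
  rw [e]
  have h1 : |2 * b * s * g| ≤ 2 * √K0 * |x| * (1 + g ^ 2) := by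
    rw [abs_mul, abs_mul, abs_mul, abs_of_nonneg hs, abs_two]
    have : |g| ≤ 1 + g ^ 2 := by nlinarith [sq_abs g, sq_nonneg (|g| - 1), abs_nonneg g]
    calc 2 * |b| * s * |g| ≤ 2 * |x| * √K0 * (1 + g ^ 2) := by gcongr
      _ = _ := by ring
  have h2 : |s ^ 2 * (g ^ 2 - 1)| ≤ K0 * (1 + g ^ 2) := by
    rw [abs_mul, abs_of_nonneg (sq_nonneg s)]
    have : |g ^ 2 - 1| ≤ 1 + g ^ 2 := by
      rw [abs_le]; constructor <;> nlinarith [sq_nonneg g]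
    gcongr
  calc _ ≤ |2 * b * s * g| + |s ^ 2 * (g ^ 2 - 1)| := by
        refine (abs_add_le _ _).trans ?_; rw [abs_neg]
    _ ≤ 2 * √K0 * |x| * (1 + g ^ 2) + K0 * (1 + g ^ 2) := add_le_add h1 h2
    _ ≤ _ := by
      have : 0 ≤ (1 + g ^ 2) * (2 * √K0 + K0 * |x|) := by positivity
      nlinarith

lemma qX_mean (b s : ℝ) : ∫ g, qX b s g ∂(gaussianReal 0 1) = 0 := by
  have e : ∀ g, qX b s g = (-(2 * b * s)) * g + s ^ 2 * g ^ 2 - s ^ 2 := by intro g; unfold qX; ring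
  simp_rw [e]
  have i1 : Integrable (fun g : ℝ => g) (gaussianReal 0 1) := by
    have := gint 1 1
    simp only [pow_one] at this
    exact (integrable_norm_iff (by fun_prop)).1 this
  have i2 : Integrable (fun g : ℝ => g ^ 2) (gaussianReal 0 1) := by simpa using gint 1 2
  rw [integral_sub (by exact (i1.const_mul _).add (i2.const_mul _)) (integrable_const _),
    integral_add (i1.const_mul _) (i2.const_mul _), integral_const_mul, integral_const_mul]
  have h1 := g1 1
  have h2 := g2 1
  simp only [NNReal.coe_one] at h1 h2
  rw [h1, h2]; simp

lemma qX_pow {b s x K0 : ℝ} (hb : |b| ≤ |x|) (hs : 0 ≤ s) (hs2 : s ^ 2 ≤ K0) (k : ℕ) :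
    Integrable (fun g => |qX b s g| ^ k) (gaussianReal 0 1) ∧
    ∫ g, |qX b s g| ^ k ∂(gaussianReal 0 1) ≤ ((2 * √K0 + K0) * (1 + |x|)) ^ k * Mk k := by
  have hb' : ∀ g, |qX b s g| ^ k ≤ ((2 * √K0 + K0) * (1 + |x|)) ^ k * (1 + g ^ 2) ^ k := by
    intro g
    rw [← mul_pow]
    exact pow_le_pow_left₀ (abs_nonneg _) (qX_bound hb hs hs2 g) k
  have hi : Integrable (fun g => |qX b s g| ^ k) (gaussianReal 0 1) := by
    refine ((int_poly k).const_mul (((2 * √K0 + K0) * (1 + |x|)) ^ k)).mono'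
      (((qX_meas b s).abs.pow_const k).aestronglyMeasurable) (ae_of_all _ fun g => ?_)
    rw [Real.norm_of_nonneg (by positivity)]
    exact hb' g
  refine ⟨hi, ?_⟩
  unfold Mk
  rw [← integral_const_mul]
  exact integral_mono hi ((int_poly k).const_mul _) hb'

/-- window lower bound for quadratic forms -/
lemma qwindow {n : ℕ} (b s x : Fin n → ℝ) {K0 L τ V : ℝ} (hK : 0 ≤ K0) (hb : ∀ i, |b i| ≤ |x i|) (hs : ∀ i, 0 ≤ s i)
    (hs2 : ∀ i, s i ^ 2 ≤ K0) (hL : ∑ i, (1 + |x i|) ^ 3 ≤ L) (hτ : 0 < τ)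
    (hV : 0 < V) (hVL : (2 * √K0 + K0) ^ 2 * Mk 2 * L ≤ V) (hτV : τ ≤ √V) :
    τ / (4 * √V) - 2 * Kst / τ ^ 3 * ((2 * √K0 + K0) ^ 3 * (Mk 3 + c3 * √(Mk 2) ^ 3) * L)
      ≤ (gam n).real {g | |∑ i, qX (b i) (s i) (g i)| ≤ 2 * τ} := by
  have hK0 : 0 ≤ 2 * √K0 + K0 := by positivity
  have hc3 : 0 ≤ c3 := integral_nonneg fun y => by positivity
  let v : Fin n → ℝ≥0 := fun i => ⟨∫ g, |qX (b i) (s i) g| ^ 2 ∂(gaussianReal 0 1),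
    integral_nonneg fun g => by positivity⟩
  have hv : ∀ i, (v i : ℝ) ≤ (2 * √K0 + K0) ^ 2 * (1 + |x i|) ^ 2 * Mk 2 := by
    intro i
    have := (qX_pow (hb i) (hs i) (hs2 i) 2).2
    rw [mul_pow] at this
    exact this
  have W := window_bound (P := gam n) (X := fun i g => qX (b i) (s i) (g i))
    (fun i => (qX_meas _ _).comp (measurable_pi_apply i))
    (iIndepFun_pi (μ := fun _ => gaussianReal 0 1) (X := fun i => qX (b i) (s i))
      (fun i => (qX_meas _ _).aemeasurable)) v
    (fun i => by rw [pi_int i _ (qX_meas _ _), qX_mean])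
    (fun i => by
      rw [pi_int i (fun g => qX (b i) (s i) g ^ 2) ((qX_meas _ _).pow_const 2)]
      simp only [v, sq_abs]; rfl)
    (fun i => pi_integrable i _ (qX_pow (hb i) (hs i) (hs2 i) 3).1) Finset.univ hτ
  have hKp := Kst_pos
  refine le_trans ?_ W
  refine sub_le_sub ?_ ?_
  · refine gsmall hV ?_ hτ hτV
    refine le_trans ?_ hVL
    push_cast
    calc ∑ i, (v i : ℝ) ≤ ∑ i, (2 * √K0 + K0) ^ 2 * Mk 2 * (1 + |x i|) ^ 3 := by
          refine Finset.sum_le_sum fun i _ => (hv i).trans ?_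
          have h1 : (1 + |x i|) ^ 2 ≤ (1 + |x i|) ^ 3 := 
            pow_le_pow_right₀ (by linarith [abs_nonneg (x i)]) (by norm_num)
          have := Mk_pos 2
          nlinarith [mul_le_mul_of_nonneg_left h1 (show 0 ≤ (2 * √K0 + K0) ^ 2 * Mk 2 by positivity)]
      _ ≤ _ := by
        rw [← Finset.mul_sum]
        have := Mk_pos 2
        gcongr
  · have hM2 := Mk_pos 2
    have hM3 := Mk_pos 3
    refine mul_le_mul_of_nonneg_left ?_ (by positivity)
    · calc _ ≤ ∑ i, (2 * √K0 + K0) ^ 3 * (Mk 3 + c3 * √(Mk 2) ^ 3) * (1 + |x i|) ^ 3 := by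
            refine Finset.sum_le_sum fun i _ => ?_
            rw [pi_int i (fun g => |qX (b i) (s i) g| ^ 3) ((qX_meas _ _).abs.pow_const 3)]
            have h3 := (qX_pow (hb i) (hs i) (hs2 i) 3).2
            have h4 : √(v i) ≤ (2 * √K0 + K0) * (1 + |x i|) * √(Mk 2) := by
              apply Real.sqrt_le_iff.2
              refine ⟨by positivity, ?_⟩
              rw [mul_pow, Real.sq_sqrt (by linarith), mul_pow]
              exact hv i
            have h5 : √(v i) ^ 3 ≤ ((2 * √K0 + K0) * (1 + |x i|) * √(Mk 2)) ^ 3 := by gcongr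
            have h6 := mul_le_mul_of_nonneg_left h5 hc3
            rw [mul_pow] at h3
            calc _ ≤ (2 * √K0 + K0) ^ 3 * (1 + |x i|) ^ 3 * Mk 3
                    + c3 * ((2 * √K0 + K0) * (1 + |x i|) * √(Mk 2)) ^ 3 := add_le_add h3 h6
              _ = _ := by ring
        _ ≤ _ := by
          rw [← Finset.mul_sum]
          gcongr

end GMX
end

section
namespace GMX


/-- mean of tilted distortion -/
def tm (t ν x : ℝ) : ℝ := x ^ 2 / (1 + 2 * t * ν) ^ 2 + ν / (1 + 2 * t * ν)

lemma tl_conc {t s ν x : ℝ} (ht : 0 ≤ t) (hs : 0 ≤ s) (hν : 0 ≤ ν) :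
    tl t ν x ≤ tl s ν x + tm s ν x * (t - s) := by
  have hp : 0 < 1 + 2 * t * ν := by positivity
  have hq : 0 < 1 + 2 * s * ν := by positivity
  unfold tl tm
  have h1 : Real.log (1 + 2 * t * ν) - Real.log (1 + 2 * s * ν) ≤ 2 * ν / (1 + 2 * s * ν) * (t - s) := by
    rw [← Real.log_div hp.ne' hq.ne']
    refine (Real.log_le_sub_one_of_pos (by positivity)).trans (le_of_eq ?_)
    field_simp; ring
  have h2 : t / (1 + 2 * t * ν) - s / (1 + 2 * s * ν) ≤ (t - s) / (1 + 2 * s * ν) ^ 2 := by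
    have : (t - s) / (1 + 2 * s * ν) ^ 2 - (t / (1 + 2 * t * ν) - s / (1 + 2 * s * ν))
      = 2 * ν * (t - s) ^ 2 / ((1 + 2 * s * ν) ^ 2 * (1 + 2 * t * ν)) := by
      field_simp; ring
    have h3 : 0 ≤ 2 * ν * (t - s) ^ 2 / ((1 + 2 * s * ν) ^ 2 * (1 + 2 * t * ν)) := by positivity
    linarith
  have h4 := mul_le_mul_of_nonneg_left h2 (sq_nonneg x)
  have e1 : t * x ^ 2 / (1 + 2 * t * ν) = x ^ 2 * (t / (1 + 2 * t * ν)) := by ring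
  have e2 : s * x ^ 2 / (1 + 2 * s * ν) = x ^ 2 * (s / (1 + 2 * s * ν)) := by ring
  have e3 : (x ^ 2 / (1 + 2 * s * ν) ^ 2 + ν / (1 + 2 * s * ν)) * (t - s) =
    x ^ 2 * ((t - s) / (1 + 2 * s * ν) ^ 2) + 1 / 2 * (2 * ν / (1 + 2 * s * ν) * (t - s)) := by ring
  rw [e1, e2, e3]
  nlinarith

lemma tm_decr {t s ν x K0 T : ℝ} (hs : 0 ≤ s) (hst : s ≤ t) (htT : t ≤ T) (hν : 0 ≤ ν) (hK : ν ≤ K0) :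
    tm t ν x + 2 * ν ^ 2 * (t - s) / (1 + 2 * T * K0) ^ 2 ≤ tm s ν x := by
  have ht : 0 ≤ t := hs.trans hst
  have hp : 0 < 1 + 2 * t * ν := by positivity
  have hq : 0 < 1 + 2 * s * ν := by positivity
  have hpq : 1 + 2 * s * ν ≤ 1 + 2 * t * ν := by gcongr
  have hpT : 1 + 2 * t * ν ≤ 1 + 2 * T * K0 := by gcongr; linarith
  unfold tm
  have h1 : x ^ 2 / (1 + 2 * t * ν) ^ 2 ≤ x ^ 2 / (1 + 2 * s * ν) ^ 2 := by gcongr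
  have h2 : ν / (1 + 2 * s * ν) - ν / (1 + 2 * t * ν) = 2 * ν ^ 2 * (t - s) / ((1 + 2 * t * ν) * (1 + 2 * s * ν)) := by
    field_simp; ring
  have h3 : 2 * ν ^ 2 * (t - s) / (1 + 2 * T * K0) ^ 2 ≤ 2 * ν ^ 2 * (t - s) / ((1 + 2 * t * ν) * (1 + 2 * s * ν)) := by
    have : 0 ≤ t - s := by linarith
    gcongr
    nlinarith
  linarith

lemma cube4 {y : ℝ} (hy : 0 ≤ y) : (1 + y) ^ 3 ≤ 4 + 4 * y ^ 3 := by
  nlinarith [mul_nonneg (by linarith : 0 ≤ 1 + y) (sq_nonneg (y - 1))]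

set_option maxHeartbeats 1000000 in
lemma core_det {n : ℕ} {t0 K0 c ℓ B K : ℝ} (ν x : Fin n → ℝ) (hn : 0 < n) (ht0 : 0 < t0) (hK0 : 0 ≤ K0)
    (hc : 0 < c) (hℓ : 1 ≤ ℓ) (hν : ∀ i, 0 ≤ ν i) (hνK : ∀ i, ν i ≤ K0) (hνc : c * n ≤ ∑ i, ν i ^ 2)
    (hB : |∑ i, tm t0 (ν i) (x i) - B| ≤ √n * ℓ) (hx : ∑ i, |x i| ^ 3 ≤ n * ℓ)
    (hK : K = (1 + 4 * t0 * K0) ^ 2 / c)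
    (hE2 : K * ℓ / √n ≤ t0) (hE3 : ℓ ^ 3 ≤ √n) {c2 c4 : ℝ} (hc2 : 1 ≤ c2)
    (hc2' : (2 * √K0 + K0) ^ 2 * Mk 2 * 8 ≤ c2)
    (hc4 : 2 * Kst * 64 * ((2 * √K0 + K0) ^ 3 * (Mk 3 + c3 * √(Mk 2) ^ 3) * 8) ≤ c4)
    (hE4 : c4 * (ℓ ^ 6 / √n) + ℓ ^ 3 / √n ≤ 1 / (16 * √c2)) :
    Real.exp (-(∑ i, tl t0 (ν i) (x i)) + t0 * B - (K + 2 * t0 + 1) * (√n / ℓ))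
      ≤ (gam n).real {h | ∑ i, (x i - √(ν i) * h i) ^ 2 ≤ B} := by
  have hn1 : (1 : ℝ) ≤ n := by exact_mod_cast hn
  have hR : 0 < √(n : ℝ) := Real.sqrt_pos.2 (by linarith)
  have hR2 : √(n : ℝ) ^ 2 = n := Real.sq_sqrt (by linarith)
  have hKp : 0 ≤ K := by rw [hK]; positivity
  set R := √(n : ℝ) with hRdef
  set δ := K * ℓ / R with hδ
  have hδ0 : 0 ≤ δ := by positivity
  set τ := R / ℓ with hτdef
  have hτ : 0 < τ := by positivity
  have hτle : τ ≤ R * ℓ := by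
    rw [hτdef, div_le_iff₀ (by linarith)]
    have : 1 ≤ ℓ * ℓ := one_le_mul_of_one_le_of_one_le hℓ hℓ
    rw [mul_assoc]; exact le_mul_of_one_le_right hR.le this
  let m : ℝ → ℝ := fun t => ∑ i, tm t (ν i) (x i)
  have hdec : ∀ s t, 0 ≤ s → s ≤ t → t ≤ 2 * t0 → m t + 2 * c * n * (t - s) / (1 + 4 * t0 * K0) ^ 2 ≤ m s := by
    intro s t hs hst htT
    calc m t + 2 * c * n * (t - s) / (1 + 4 * t0 * K0) ^ 2
        = m t + 2 * (t - s) / (1 + 4 * t0 * K0) ^ 2 * (c * n) := by ring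
      _ ≤ m t + 2 * (t - s) / (1 + 4 * t0 * K0) ^ 2 * ∑ i, ν i ^ 2 := by
          have : 0 ≤ 2 * (t - s) / (1 + 4 * t0 * K0) ^ 2 := by
            have : 0 ≤ t - s := by linarith
            positivity
          have := mul_le_mul_of_nonneg_left hνc this
          linarith
      _ = ∑ i, (tm t (ν i) (x i) + 2 * ν i ^ 2 * (t - s) / (1 + 2 * (2 * t0) * K0) ^ 2) := by
          simp only [m]
          rw [Finset.mul_sum, ← Finset.sum_add_distrib]
          refine Finset.sum_congr rfl fun i _ => ?_
          ring
      _ ≤ m s := Finset.sum_le_sum fun i _ => tm_decr hs hst htT (hν i) (hνK i)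
  have hdel : 2 * c * n * δ / (1 + 4 * t0 * K0) ^ 2 = 2 * (R * ℓ) := by
    have h0 : (1 + 4 * t0 * K0) ^ 2 ≠ 0 := by positivity
    rw [hδ, hK, ← hR2]
    field_simp
  have hd1 := hdec (t0 - δ) t0 (by linarith) (by linarith) (by linarith)
  have hd2 := hdec t0 (t0 + δ) (by linarith) (by linarith) (by linarith)
  rw [show t0 - (t0 - δ) = δ by ring, hdel] at hd1
  rw [show t0 + δ - t0 = δ by ring, hdel] at hd2
  have hB' := abs_le.1 hB
  have hmt0 : m t0 = ∑ i, tm t0 (ν i) (x i) := rfl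
  rw [← hmt0] at hB'
  have hRl : 0 < R * ℓ := by positivity
  have hcont : ContinuousOn m (Set.Icc (t0 - δ) (t0 + δ)) := by
    simp only [m]
    refine continuousOn_finsetSum _ fun i _ => ?_
    unfold tm
    have hpos : ∀ t ∈ Set.Icc (t0 - δ) (t0 + δ), 1 + 2 * t * ν i ≠ 0 := by
      intro t ht
      have h1 : 0 ≤ t := by linarith [ht.1]
      have := hν i
      positivity
    refine ContinuousOn.add (ContinuousOn.div (by fun_prop) (by fun_prop) fun t ht => pow_ne_zero 2 (hpos t ht))
      (ContinuousOn.div (by fun_prop) (by fun_prop) hpos)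
  obtain ⟨t, htmem, htm⟩ : B - τ / 2 ∈ m '' Set.Icc (t0 - δ) (t0 + δ) := by
    apply intermediate_value_Icc' (by linarith) hcont
    constructor <;> linarith [hB'.1, hB'.2]
  have ht : 0 ≤ t := by linarith [htmem.1]
  have htt : |t - t0| ≤ δ := by rw [abs_le]; constructor <;> linarith [htmem.1, htmem.2]
  have T := tilt t B τ ν x ht hν
  have hp : ∀ i, 0 < 1 + 2 * t * ν i := fun i => by have := hν i; positivity
  have hset : {g : Fin n → ℝ | |∑ i, qX (x i / (1 + 2 * t * ν i)) √(ν i / (1 + 2 * t * ν i)) (g i)| ≤ 2 * (τ / 4)}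
      = {g | B - τ ≤ ∑ i, (x i / (1 + 2 * t * ν i) - √(ν i / (1 + 2 * t * ν i)) * g i) ^ 2
        ∧ ∑ i, (x i / (1 + 2 * t * ν i) - √(ν i / (1 + 2 * t * ν i)) * g i) ^ 2 ≤ B} := by
    ext g
    have : ∑ i, qX (x i / (1 + 2 * t * ν i)) √(ν i / (1 + 2 * t * ν i)) (g i) =
      ∑ i, (x i / (1 + 2 * t * ν i) - √(ν i / (1 + 2 * t * ν i)) * g i) ^ 2 - m t := by
      simp only [m]
      rw [← Finset.sum_sub_distrib]
      refine Finset.sum_congr rfl fun i _ => ?_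
      unfold qX tm
      rw [Real.sq_sqrt (div_nonneg (hν i) (hp i).le), div_pow]
    simp only [Set.mem_ofPred_eq]
    rw [this, htm, abs_le]
    constructor
    · rintro ⟨h1, h2⟩; constructor <;> linarith
    · rintro ⟨h1, h2⟩; constructor <;> linarith
  have hL : ∑ i, (1 + |x i|) ^ 3 ≤ 8 * (n * ℓ) := by
    calc ∑ i, (1 + |x i|) ^ 3 ≤ ∑ i : Fin n, (4 + 4 * |x i| ^ 3) := by
          refine Finset.sum_le_sum fun i _ => ?_
          exact cube4 (abs_nonneg (x i))
      _ = 4 * n + 4 * ∑ i, |x i| ^ 3 := by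
          rw [Finset.sum_add_distrib, ← Finset.mul_sum]; simp; ring
      _ ≤ _ := by
        have h9 : (n:ℝ) ≤ n * ℓ := le_mul_of_one_le_right (by linarith) hℓ
        linarith
  have hV : (0:ℝ) < c2 * (n * ℓ) := by positivity
  have hMk2 := Mk_pos 2
  have hW := qwindow (fun i => x i / (1 + 2 * t * ν i)) (fun i => √(ν i / (1 + 2 * t * ν i))) x
    (K0 := K0) (L := 8 * (n * ℓ)) (τ := τ / 4) (V := c2 * (n * ℓ)) hK0
    (fun i => by
      rw [abs_div, abs_of_pos (hp i)]
      apply div_le_self (abs_nonneg _)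
      have := hν i
      have : 0 ≤ t * ν i := by positivity
      linarith) (fun i => Real.sqrt_nonneg _)
    (fun i => by
      rw [Real.sq_sqrt (div_nonneg (hν i) (hp i).le)]
      refine (div_le_self (hν i) ?_).trans (hνK i)
      have := hν i
      have : 0 ≤ t * ν i := by positivity
      linarith) hL (by positivity) hV
    (by
      have : (0:ℝ) ≤ n * ℓ := by positivity
      have h9 := mul_le_mul_of_nonneg_right hc2' this
      linarith)
    (by
      apply Real.le_sqrt_of_sq_le
      have h1 : τ / 4 ≤ R := by
        rw [hτdef]
        have : R / ℓ ≤ R := div_le_self hR.le hℓ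
        linarith
      have h2 : (τ / 4) ^ 2 ≤ R ^ 2 := by gcongr
      rw [hR2] at h2
      refine h2.trans ?_
      have h8 : (n:ℝ) ≤ n * ℓ := le_mul_of_one_le_right (by linarith) hℓ
      exact h8.trans (le_mul_of_one_le_left (by positivity) hc2))
  rw [hset] at hW
  have hw1 : ℓ ^ 3 / R * (1 / ℓ ^ 2) ≤ (gam n).real {g | B - τ ≤ ∑ i, (x i / (1 + 2 * t * ν i) - √(ν i / (1 + 2 * t * ν i)) * g i) ^ 2
        ∧ ∑ i, (x i / (1 + 2 * t * ν i) - √(ν i / (1 + 2 * t * ν i)) * g i) ^ 2 ≤ B} := by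
    refine le_trans ?_ hW
    have hc2p : 0 < √c2 := Real.sqrt_pos.2 (by linarith)
    have a1 : 1 / (16 * √c2) * (1 / ℓ ^ 2) ≤ τ / 4 / (4 * √(c2 * (n * ℓ))) := by
      rw [Real.sqrt_mul (by linarith), Real.sqrt_mul (by linarith), ← hRdef, hτdef]
      have hsl : √ℓ ≤ ℓ := by
        rw [Real.sqrt_le_left (by linarith)]; exact le_self_pow₀ hℓ two_ne_zero
      have hslp : 0 < √ℓ := Real.sqrt_pos.2 (by linarith)
      rw [show R / ℓ / 4 / (4 * (√c2 * (R * √ℓ))) = 1 / (16 * √c2) * (1 / (ℓ * √ℓ)) by field_simp; ring]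
      gcongr
      rw [sq]; gcongr
    have a2 : 2 * Kst / (τ / 4) ^ 3 * ((2 * √K0 + K0) ^ 3 * (Mk 3 + c3 * √(Mk 2) ^ 3) * (8 * (n * ℓ)))
        ≤ c4 * (ℓ ^ 6 / R) * (1 / ℓ ^ 2) := by
      have : 2 * Kst / (τ / 4) ^ 3 * ((2 * √K0 + K0) ^ 3 * (Mk 3 + c3 * √(Mk 2) ^ 3) * (8 * (n * ℓ)))
        = 2 * Kst * 64 * ((2 * √K0 + K0) ^ 3 * (Mk 3 + c3 * √(Mk 2) ^ 3) * 8) * (ℓ ^ 4 / R) := by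
        rw [hτdef, ← hR2]
        field_simp; ring
      rw [this, show c4 * (ℓ ^ 6 / R) * (1 / ℓ ^ 2) = c4 * (ℓ ^ 4 / R) by field_simp]
      gcongr
    have a3 := mul_le_mul_of_nonneg_right hE4 (show 0 ≤ 1 / ℓ ^ 2 by positivity)
    rw [add_mul] at a3
    linarith
  have hw2 : Real.exp (-(R / ℓ)) ≤ ℓ ^ 3 / R * (1 / ℓ ^ 2) := by
    rw [show ℓ ^ 3 / R * (1 / ℓ ^ 2) = (R / ℓ)⁻¹ by field_simp, Real.exp_neg]
    apply inv_anti₀ (by positivity)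
    linarith [Real.add_one_le_exp (R / ℓ)]
  have hconc : ∑ i, tl t (ν i) (x i) ≤ ∑ i, tl t0 (ν i) (x i) + m t0 * (t - t0) := by
    simp only [m]
    rw [Finset.sum_mul, ← Finset.sum_add_distrib]
    exact Finset.sum_le_sum fun i _ => tl_conc ht ht0.le (hν i)
  have hquad : (m t0 - B) * (t - t0) ≤ K * (R / ℓ) := by
    calc (m t0 - B) * (t - t0) ≤ |m t0 - B| * |t - t0| := by rw [← abs_mul]; exact le_abs_self _
      _ ≤ (R * ℓ) * δ := by
        apply mul_le_mul _ htt (abs_nonneg _) hRl.le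
        exact hB
      _ = K * ℓ ^ 2 := by rw [hδ]; field_simp
      _ ≤ _ := by
        apply mul_le_mul_of_nonneg_left _ hKp
        rw [le_div_iff₀ (by linarith)]
        calc ℓ ^ 2 * ℓ = ℓ ^ 3 := by ring
          _ ≤ R := hE3
  refine le_trans ?_ T
  calc _ ≤ Real.exp (-(∑ i, tl t (ν i) (x i)) + t * (B - τ)) * Real.exp (-(R / ℓ)) := by
        rw [← Real.exp_add]
        apply Real.exp_le_exp.2
        have : t * τ ≤ 2 * t0 * τ := by
          apply mul_le_mul_of_nonneg_right _ hτ.le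
          linarith [htmem.2]
        rw [← hτdef] at hquad ⊢
        linarith
    _ ≤ _ := by
      apply mul_le_mul_of_nonneg_left (hw2.trans hw1) (Real.exp_pos _).le

lemma lim_pow (k : ℕ) : Tendsto (fun n : ℕ => Real.log n ^ k / √(n : ℝ)) atTop (nhds 0) := by
  have h := (isLittleO_log_rpow_rpow_atTop (k : ℝ) (show (0:ℝ) < 1 / 2 by norm_num)).tendsto_div_nhds_zero
  have h2 := h.comp tendsto_natCast_atTop_atTop
  refine h2.congr fun n => ?_
  simp [Real.sqrt_eq_rpow]

lemma lim_log : Tendsto (fun n : ℕ => Real.log n) atTop atTop :=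
  Real.tendsto_log_atTop.comp tendsto_natCast_atTop_atTop

lemma core (t0 K0 c : ℝ) (ht0 : 0 < t0) (hK0 : 0 ≤ K0) (hc : 0 < c) : ∃ C : ℝ, 0 ≤ C ∧ ∀ᶠ n : ℕ in atTop,
    ∀ (B : ℝ) (ν x : Fin n → ℝ), (∀ i, 0 ≤ ν i) → (∀ i, ν i ≤ K0) → (c * n ≤ ∑ i, ν i ^ 2) →
    (|∑ i, tm t0 (ν i) (x i) - B| ≤ √n * Real.log n) → (∑ i, |x i| ^ 3 ≤ n * Real.log n) →
    Real.exp (-(∑ i, tl t0 (ν i) (x i)) + t0 * B - C * (√n / Real.log n))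
      ≤ (gam n).real {h | ∑ i, (x i - √(ν i) * h i) ^ 2 ≤ B} := by
  set K := (1 + 4 * t0 * K0) ^ 2 / c with hK
  refine ⟨K + 2 * t0 + 1, by positivity, ?_⟩
  set c2 := max 1 ((2 * √K0 + K0) ^ 2 * Mk 2 * 8)
  set c4 := 2 * Kst * 64 * ((2 * √K0 + K0) ^ 3 * (Mk 3 + c3 * √(Mk 2) ^ 3) * 8)
  have hc2 : 1 ≤ c2 := le_max_left _ _
  have l1 : ∀ᶠ n : ℕ in atTop, K * (Real.log n ^ 1 / √(n : ℝ)) < t0 := by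
    have := (lim_pow 1).const_mul K
    rw [mul_zero] at this
    exact this.eventually (gt_mem_nhds ht0)
  have l2 : ∀ᶠ n : ℕ in atTop, Real.log n ^ 3 / √(n : ℝ) < 1 :=
    (lim_pow 3).eventually (gt_mem_nhds one_pos)
  have l3 : ∀ᶠ n : ℕ in atTop, c4 * (Real.log n ^ 6 / √(n : ℝ)) + Real.log n ^ 3 / √(n : ℝ) < 1 / (16 * √c2) := by
    have := ((lim_pow 6).const_mul c4).add (lim_pow 3)
    rw [mul_zero, add_zero] at this
    exact this.eventually (gt_mem_nhds (by positivity))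
  filter_upwards [l1, l2, l3, lim_log.eventually_ge_atTop 1, eventually_gt_atTop 0] with n h1 h2 h3 h4 h5
  intro B ν x a1 a2 a3 a4 a5
  have hR : 0 < √(n : ℝ) := Real.sqrt_pos.2 (by exact_mod_cast h5)
  exact core_det ν x h5 ht0 hK0 hc h4 a1 a2 a3 a4 a5 hK
    (by rw [pow_one, ← mul_div_assoc] at h1; exact h1.le)
    (by rw [div_lt_one hR] at h2; exact h2.le) hc2 (le_max_right _ _) le_rfl h3.le

end GMX
end

section
namespace GMX


section code
variable {X Y : Type*} [MeasurableSpace X] [MeasurableSpace Y] (μ : Measure X) (ρ : Measure Y)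
  [IsProbabilityMeasure μ] [IsProbabilityMeasure ρ]

lemma cb_step (D : X × Y → Prop) (hD : MeasurableSet {p | D p}) (A : Set X) (hA : MeasurableSet A)
    (p : ℝ) (hp1 : p ≤ 1) (h : ∀ x ∈ A, p ≤ ρ.real {y | D (x, y)}) :
    ∃ y, μ.real (A ∩ {x | ¬ D (x, y)}) ≤ (1 - p) * μ.real A := by
  have hm : MeasurableSet ((A ×ˢ (Set.univ : Set Y)) ∩ {p | D p}ᶜ) := (hA.prod MeasurableSet.univ).inter hD.compl
  have e1 := Measure.prod_apply (μ := μ) (ν := ρ) hm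
  have e2 := Measure.prod_apply_symm (μ := μ) (ν := ρ) hm
  have b1 : ∫⁻ x, ρ (Prod.mk x ⁻¹' ((A ×ˢ (Set.univ : Set Y)) ∩ {p | D p}ᶜ)) ∂μ ≤ ENNReal.ofReal (1 - p) * μ A := by
    rw [← setLIntegral_const, ← lintegral_indicator hA]
    refine lintegral_mono fun x => ?_
    by_cases hx : x ∈ A
    · rw [Set.indicator_of_mem hx]
      have hs : Prod.mk x ⁻¹' ((A ×ˢ (Set.univ : Set Y)) ∩ {p | D p}ᶜ) = {y | D (x, y)}ᶜ := by
        ext y; simp [hx]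
      rw [hs]
      have hDx : MeasurableSet {y | D (x, y)} := measurable_prodMk_left hD
      rw [← ofReal_measureReal, probReal_compl_eq_one_sub hDx]
      exact ENNReal.ofReal_le_ofReal (by linarith [h x hx])
    · have hs : Prod.mk x ⁻¹' ((A ×ˢ (Set.univ : Set Y)) ∩ {p | D p}ᶜ) = ∅ := by
        ext y; simp [hx]
      rw [hs]; simp
  rw [← e1, e2] at b1
  obtain ⟨y, hy⟩ := exists_le_lintegral (μ := ρ) (f := fun y => μ ((fun x => (x, y)) ⁻¹' ((A ×ˢ (Set.univ : Set Y)) ∩ {p | D p}ᶜ)))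
    (measurable_measure_prodMk_right hm).aemeasurable
  refine ⟨y, ?_⟩
  have hs : (fun x => (x, y)) ⁻¹' ((A ×ˢ (Set.univ : Set Y)) ∩ {p | D p}ᶜ) = A ∩ {x | ¬ D (x, y)} := by
    ext x; simp
  rw [hs] at hy
  have := ENNReal.toReal_mono (ENNReal.mul_ne_top ENNReal.ofReal_ne_top (measure_ne_top _ _)) (hy.trans b1)
  rw [ENNReal.toReal_mul, ENNReal.toReal_ofReal (by linarith)] at this
  exact this

lemma codebook (D : X × Y → Prop) (hD : MeasurableSet {p | D p}) (A : Set X) (hA : MeasurableSet A)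
    (p : ℝ) (hp1 : p ≤ 1) (h : ∀ x ∈ A, p ≤ ρ.real {y | D (x, y)}) (N : ℕ) :
    ∃ ys : Fin N → Y, μ.real (A ∩ {x | ∀ j, ¬ D (x, ys j)}) ≤ (1 - p) ^ N := by
  induction N with
  | zero => exact ⟨Fin.elim0, by simp⟩
  | succ N ih =>
    obtain ⟨ys, hys⟩ := ih
    have hm : MeasurableSet (A ∩ {x | ∀ j, ¬ D (x, ys j)}) := by
      refine hA.inter ?_
      have : {x | ∀ j, ¬ D (x, ys j)} = ⋂ j, {x | D (x, ys j)}ᶜ := by ext x; simp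
      rw [this]
      exact MeasurableSet.iInter fun j => (measurable_prodMk_right (y := ys j) hD).compl
    obtain ⟨y, hy⟩ := cb_step μ ρ D hD _ hm p hp1 (fun x hx => h x hx.1)
    refine ⟨Fin.snoc ys y, ?_⟩
    have hs : A ∩ {x | ∀ j, ¬ D (x, (Fin.snoc ys y : Fin (N + 1) → Y) j)} = 
        A ∩ {x | ∀ j, ¬ D (x, ys j)} ∩ {x | ¬ D (x, y)} := by
      ext x
      simp [Fin.forall_fin_succ', and_assoc]
    rw [hs]
    calc _ ≤ _ := hy
      _ ≤ (1 - p) * (1 - p) ^ N := by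
        apply mul_le_mul_of_nonneg_left hys (by linarith)
      _ = _ := by ring

end code

/-- code from a finite codebook -/
lemma mkcode (a σ d ε : ℝ) (n M : ℕ) (hM : 0 < M) (cs : Fin M → (Fin n → ℝ))
    (h : (GM.sourceLaw a σ n) {u | ∀ j, d < GM.distortion n u (cs j)} ≤ ENNReal.ofReal ε) :
    GM.rate a σ n d ε ≤ Real.log M / n := by
  classical
  have hcode : GM.IsCode a σ n M d ε := by
    have hdm : ∀ j, Measurable fun u => GM.distortion n u (cs j) := by
      intro j; unfold GM.distortion; fun_prop
    let f : (Fin n → ℝ) → Fin M := fun u =>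
      if hu : ∃ j, GM.distortion n u (cs j) ≤ d then Fin.find (fun j => GM.distortion n u (cs j) ≤ d) hu else ⟨0, hM⟩
    refine ⟨f, cs, ?_, ?_⟩
    · refine measurable_to_countable' fun j => ?_
      have h1 : MeasurableSet {u | ∃ j, GM.distortion n u (cs j) ≤ d} := by
        have : {u | ∃ j, GM.distortion n u (cs j) ≤ d} = ⋃ j, {u | GM.distortion n u (cs j) ≤ d} := by ext; simp
        rw [this]
        exact MeasurableSet.iUnion fun j => measurableSet_le (hdm j) measurable_const
      have h2 : MeasurableSet {u | GM.distortion n u (cs j) ≤ d ∧ ∀ k < j, ¬ GM.distortion n u (cs k) ≤ d} := by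
        have : {u | GM.distortion n u (cs j) ≤ d ∧ ∀ k < j, ¬ GM.distortion n u (cs k) ≤ d} =
          {u | GM.distortion n u (cs j) ≤ d} ∩ ⋂ k, ⋂ (_ : k < j), {u | GM.distortion n u (cs k) ≤ d}ᶜ := by
          ext; simp
        rw [this]
        exact (measurableSet_le (hdm j) measurable_const).inter
          (MeasurableSet.iInter fun k => MeasurableSet.iInter fun _ => (measurableSet_le (hdm k) measurable_const).compl)
      have h3 : f ⁻¹' {j} = ({u | GM.distortion n u (cs j) ≤ d ∧ ∀ k < j, ¬ GM.distortion n u (cs k) ≤ d})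
          ∪ ({u | ∃ j, GM.distortion n u (cs j) ≤ d}ᶜ ∩ {_u | j = ⟨0, hM⟩}) := by
        ext u
        simp only [Set.mem_preimage, Set.mem_singleton_iff, f]
        by_cases hu : ∃ j, GM.distortion n u (cs j) ≤ d
        · rw [dif_pos hu, Fin.find_eq_iff]
          simp [hu]
        · rw [dif_neg hu]
          have hu' := hu
          push Not at hu'
          simp only [Set.mem_union, Set.mem_inter_iff, Set.mem_compl_iff, Set.mem_ofPred_eq, hu, not_false_eq_true, true_and]
          constructor
          · intro e; exact Or.inr e.symm
          · rintro (⟨e, _⟩ | e)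
            · exact absurd e (not_le.2 (hu' j))
            · exact e.symm
      rw [h3]
      exact h2.union (h1.compl.inter (MeasurableSet.const _))
    · refine (measure_mono fun u hu => ?_).trans h
      simp only [Set.mem_ofPred_eq] at hu ⊢
      by_contra hne
      push Not at hne
      have : f u = Fin.find (fun j => GM.distortion n u (cs j) ≤ d) hne := dif_pos hne
      rw [this] at hu
      exact absurd (Fin.find_spec hne) (not_le.2 hu)
  have h1 : GM.Mstar a σ n d ε ≤ M := Nat.sInf_le hcode
  unfold GM.rate
  apply div_le_div_of_nonneg_right _ (Nat.cast_nonneg _)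
  rcases Nat.eq_zero_or_pos (GM.Mstar a σ n d ε) with h0 | h0
  · rw [h0]; simp
    exact Real.log_natCast_nonneg M
  · exact Real.log_le_log (by exact_mod_cast h0) (by exact_mod_cast h1)

end GMX
end

section
namespace GMX


lemma gam_map {m n : ℕ} (r : Fin n → Fin m → ℝ) (hr : ∀ i k, ∑ j, r i j * r k j = if i = k then 1 else 0) :
    (gam m).map (fun g i => ∑ j, r i j * g j) = gam n := by
  have hF : Measurable (fun (g : Fin m → ℝ) i => ∑ j, r i j * g j) := by fun_prop
  have hT : ∀ k, Measurable (WithLp.toLp 2 : (Fin k → ℝ) → EuclideanSpace ℝ (Fin k)) := fun k => by fun_prop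
  have key : ((gam m).map (fun g i => ∑ j, r i j * g j)).map (WithLp.toLp 2) = (gam n).map (WithLp.toLp 2) := by
    rw [map_pi_eq_stdGaussian, Measure.map_map (hT n) hF]
    apply Measure.ext_of_charFun (E := EuclideanSpace ℝ (Fin n))
    ext t
    rw [charFun_stdGaussian]
    let t' : EuclideanSpace ℝ (Fin m) := WithLp.toLp 2 (fun j => ∑ i, t i * r i j)
    have h1 := charFun_stdGaussian t'
    rw [← map_pi_eq_stdGaussian, charFun_apply, integral_map (hT m).aemeasurable (by fun_prop)] at h1
    rw [charFun_apply, integral_map ((hT n).comp hF).aemeasurable (by fun_prop)]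
    have h2 : ‖t'‖ ^ 2 = ‖t‖ ^ 2 := by
      rw [EuclideanSpace.real_norm_sq_eq, EuclideanSpace.real_norm_sq_eq]
      simp only [t']
      have : ∀ j, (∑ i, t i * r i j) ^ 2 = ∑ i, ∑ k, t i * t k * (r i j * r k j) := by
        intro j
        rw [sq, Finset.sum_mul_sum]
        refine Finset.sum_congr rfl fun i _ => Finset.sum_congr rfl fun k _ => by ring
      simp_rw [this]
      rw [Finset.sum_comm]
      refine Finset.sum_congr rfl fun i _ => ?_
      rw [Finset.sum_comm]
      simp_rw [← Finset.mul_sum, hr]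
      simp [sq]
    have h3 : ∀ g : Fin m → ℝ, inner ℝ ((WithLp.toLp 2 ∘ fun (g : Fin m → ℝ) i => ∑ j, r i j * g j) g) t
        = inner ℝ (WithLp.toLp 2 g) t' := by
      intro g
      simp only [PiLp.inner_apply, Function.comp, t', RCLike.inner_apply, conj_trivial]
      simp_rw [Finset.mul_sum, Finset.sum_mul]
      rw [Finset.sum_comm]
      refine Finset.sum_congr rfl fun i _ => Finset.sum_congr rfl fun k _ => by ring
    simp_rw [h3]
    rw [h1]
    norm_cast
    rw [h2]
  have := congrArg (Measure.map (WithLp.ofLp : EuclideanSpace ℝ (Fin n) → (Fin n → ℝ))) key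
  rw [Measure.map_map (by fun_prop) (hT n), Measure.map_map (by fun_prop) (hT n)] at this
  have e : (WithLp.ofLp : EuclideanSpace ℝ (Fin n) → (Fin n → ℝ)) ∘ (WithLp.toLp 2) = id := rfl
  rw [e, Measure.map_id, Measure.map_id] at this
  exact this

lemma gaussPi_eq (σ : ℝ) (hσ : 0 < σ) (m : ℕ) : GM.gaussPi σ m = (gam m).map (fun g i => σ * g i) := by
  unfold GM.gaussPi
  have : (fun _ : Fin m => gaussianReal 0 ⟨σ ^ 2, sq_nonneg σ⟩) = fun _ => (gaussianReal 0 1).map (fun x => σ * x) := by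
    funext i
    have key : ∀ v : ℝ≥0, (v : ℝ) = σ ^ 2 → gaussianReal 0 v = (gaussianReal 0 1).map (fun x => σ * x) := by
      intro v hv
      rw [gmap, hv, Real.sqrt_sq hσ.le]
    exact key _ rfl
  rw [this]
  exact (Measure.pi_map_pi (μ := fun _ => gaussianReal 0 1) (f := fun _ x => σ * x) (fun i => by fun_prop)).symm

instance (σ : ℝ) (n : ℕ) : IsProbabilityMeasure (GM.gaussPi σ n) := by
  have key : ∀ v : ℝ≥0, IsProbabilityMeasure (Measure.pi fun _ : Fin n => gaussianReal 0 v) := fun v => inferInstance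
  exact key _

lemma gaussPi_restrict (σ : ℝ) (hσ : 0 < σ) (n : ℕ) :
    (GM.gaussPi σ (n + 1)).map (fun z (j : Fin n) => z j.castSucc) = GM.gaussPi σ n := by
  rw [gaussPi_eq σ hσ, gaussPi_eq σ hσ, Measure.map_map (by fun_prop) (by fun_prop)]
  have h := gam_map (m := n + 1) (n := n) (fun i j => if j = i.castSucc then 1 else 0) (by
    intro i k; simp [eq_comm])
  rw [← h, Measure.map_map (by fun_prop) (by fun_prop)]
  congr 1
  ext g j
  simp

/-- summation by parts for the tridiagonal form -/
lemma sbp (a μ : ℝ) (p U : ℕ → ℝ) (hU0 : U 0 = 0)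
    (he : ∀ j, (1 + a ^ 2) * p (j + 1) - a * p j - a * p (j + 2) = μ * p (j + 1)) (N : ℕ) :
    ∑ j ∈ Finset.range N, (p (j + 1) - a * p j) * (U (j + 1) - a * U j)
      = μ * ∑ j ∈ Finset.range N, p (j + 1) * U (j + 1) + a * (p (N + 1) - a * p N) * U N := by
  induction N with
  | zero => simp [hU0]
  | succ N ih =>
    rw [Finset.sum_range_succ, ih, Finset.sum_range_succ, mul_add, ← mul_assoc μ (p (N + 1)), ← he N]
    ring

lemma wron (c c' : ℝ) (p q : ℕ → ℝ) (hp0 : p 0 = 0) (hq0 : q 0 = 0)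
    (hp : ∀ j, p (j + 2) + p j = c * p (j + 1)) (hq : ∀ j, q (j + 2) + q j = c' * q (j + 1)) (N : ℕ) :
    (c - c') * ∑ j ∈ Finset.range N, p (j + 1) * q (j + 1) = p (N + 1) * q N - p N * q (N + 1) := by
  induction N with
  | zero => simp [hp0, hq0]
  | succ N ih =>
    rw [Finset.sum_range_succ, mul_add, ih]
    have h1 := hp N
    have h2 := hq N
    linear_combination (-(q (N + 1))) * h1 + p (N + 1) * h2

def wf (n : ℕ) (i : Fin n) : ℝ := ((i : ℝ) + 1) * π / (n + 1)

lemma wf_mem (n : ℕ) (i : Fin n) : wf n i ∈ Set.Ioo 0 π := by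
  unfold wf
  have h1 : (i : ℝ) + 1 < n + 1 := by
    have : (i : ℕ) < n := i.2
    have : (i : ℝ) < n := by exact_mod_cast this
    linarith
  have := pi_pos
  constructor
  · positivity
  · rw [div_lt_iff₀ (by positivity)]
    nlinarith

lemma sin_rec (w : ℝ) (j : ℕ) : sin ((j + 2 : ℕ) * w) + sin (j * w) = 2 * cos w * sin ((j + 1 : ℕ) * w) := by
  push_cast
  rw [show ((j:ℝ) + 2) * w = (j + 1) * w + w by ring, show (j:ℝ) * w = (j + 1) * w - w by ring,
    Real.sin_add, Real.sin_sub]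
  ring

/-- DST vectors -/
lemma dst (n : ℕ) : ∃ p : Fin n → ℕ → ℝ, (∀ i, p i 0 = 0) ∧ (∀ i, p i (n + 1) = 0) ∧
    (∀ i j, p i (j + 2) + p i j = 2 * cos (wf n i) * p i (j + 1)) ∧
    (∀ i k, ∑ j ∈ Finset.range n, p i (j + 1) * p k (j + 1) = if i = k then 1 else 0) := by
  let s : Fin n → ℕ → ℝ := fun i j => sin (j * wf n i)
  let N : Fin n → ℝ := fun i => ∑ j ∈ Finset.range n, s i (j + 1) ^ 2
  have hN : ∀ i, 0 < N i := by
    intro i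
    have hn : 0 < n := i.pos
    refine lt_of_lt_of_le ?_ (Finset.single_le_sum (f := fun j => s i (j + 1) ^ 2) (fun j _ => sq_nonneg _) (Finset.mem_range.2 hn))
    have := sin_pos_of_mem_Ioo (wf_mem n i)
    simp only [s]
    simp
    positivity
  have hend : ∀ i, s i (n + 1) = 0 := by
    intro i
    simp only [s]
    have : ((n + 1 : ℕ) : ℝ) * wf n i = ((i + 1 : ℕ) : ℝ) * π := by
      unfold wf; push_cast; field_simp
    rw [this, sin_nat_mul_pi]
  refine ⟨fun i j => s i j / √(N i), fun i => by simp [s], fun i => by simp [hend], fun i j => ?_, fun i k => ?_⟩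
  · have := sin_rec (wf n i) j
    simp only [s]
    rw [← add_div, this, mul_div_assoc]
  · have e : ∀ j, s i (j + 1) / √(N i) * (s k (j + 1) / √(N k)) = (s i (j + 1) * s k (j + 1)) / (√(N i) * √(N k)) :=
      fun j => by rw [div_mul_div_comm]
    simp_rw [e]
    rw [← Finset.sum_div]
    split_ifs with h
    · subst h
      rw [← sq, Real.sq_sqrt (hN i).le, div_eq_one_iff_eq (hN i).ne']
      exact Finset.sum_congr rfl fun j _ => by ring
    · have hw := wron (2 * cos (wf n i)) (2 * cos (wf n k)) (s i) (s k) (by simp [s]) (by simp [s])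
        (fun j => sin_rec _ j) (fun j => sin_rec _ j) n
      rw [hend, hend] at hw
      have hne : 2 * cos (wf n i) - 2 * cos (wf n k) ≠ 0 := by
        intro h0
        have h1 : cos (wf n i) = cos (wf n k) := by linarith
        have h2 := Real.injOn_cos (Set.Ioo_subset_Icc_self (wf_mem n i)) (Set.Ioo_subset_Icc_self (wf_mem n k)) h1
        apply h
        unfold wf at h2
        have hpi := pi_pos
        field_simp at h2
        have : (i : ℝ) = k := by linarith
        exact Fin.ext (by exact_mod_cast this)
      have : ∑ j ∈ Finset.range n, s i (j + 1) * s k (j + 1) = 0 := by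
        rcases mul_eq_zero.1 (hw.trans (by ring : (0:ℝ) * s k n - s i n * 0 = 0)) with h | h
        · exact absurd h hne
        · exact h
      rw [this, zero_div]

end GMX
end

section
namespace GMX


def Uext (a : ℝ) (zz : ℕ → ℝ) : ℕ → ℝ
  | 0 => 0
  | k + 1 => ∑ j ∈ Finset.range (k + 1), a ^ (k - j) * zz j

lemma Uext_rec (a : ℝ) (zz : ℕ → ℝ) (k : ℕ) : Uext a zz (k + 1) - a * Uext a zz k = zz k := by
  cases k with
  | zero => simp [Uext]
  | succ k =>
    simp only [Uext]
    rw [Finset.sum_range_succ]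
    have : ∑ j ∈ Finset.range (k + 1), a ^ (k + 1 - j) * zz j = a * ∑ j ∈ Finset.range (k + 1), a ^ (k - j) * zz j := by
      rw [Finset.mul_sum]
      refine Finset.sum_congr rfl fun j hj => ?_
      rw [Finset.mem_range] at hj
      rw [show k + 1 - j = (k - j) + 1 by omega, pow_succ]; ring
    rw [this]; simp

lemma evolve_eq (a : ℝ) (m : ℕ) (z : Fin m → ℝ) (zz : ℕ → ℝ) (hz : ∀ j : Fin m, z j = zz j) (i : Fin m) :
    GM.evolve a m z i = Uext a zz (i + 1) := by
  unfold GM.evolve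
  show _ = ∑ j ∈ Finset.range ((i : ℕ) + 1), a ^ ((i : ℕ) - j) * zz j
  have : Finset.range ((i : ℕ) + 1) = (Finset.Iic i).map Fin.valEmbedding := by
    rw [Fin.map_valEmbedding_Iic]; ext; simp; try omega
  rw [this, Finset.sum_map]
  exact Finset.sum_congr rfl fun j _ => by rw [hz]; rfl

lemma minkowski {n : ℕ} (u v : Fin n → ℝ) : √(∑ i, (u i + v i) ^ 2) ≤ √(∑ i, u i ^ 2) + √(∑ i, v i ^ 2) := by
  have := norm_add_le (WithLp.toLp 2 u : EuclideanSpace ℝ (Fin n)) (WithLp.toLp 2 v)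
  simp only [EuclideanSpace.norm_eq, Real.norm_eq_abs, sq_abs] at this
  exact this

lemma den_pos {a : ℝ} (ha0 : 0 ≤ a) (ha1 : a < 1) (w : ℝ) : (1 - a) ^ 2 ≤ 1 + a ^ 2 - 2 * a * cos w := by
  nlinarith [mul_le_mul_of_nonneg_left (cos_le_one w) ha0]

lemma transfer {a σ : ℝ} (ha0 : 0 ≤ a) (ha1 : a < 1) (hσ : 0 < σ) (n : ℕ) (hn : 0 < n) :
    ∃ Gm : (Fin (n + 1) → ℝ) → (Fin n → ℝ), ∃ c : (Fin n → ℝ) → ℝ → (Fin n → ℝ), Measurable Gm ∧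
      (GM.gaussPi σ (n + 1)).map Gm = gam n ∧ ∀ z y q,
        √(∑ j, (GM.evolve a n (fun j => z j.castSucc) j - c y q j) ^ 2) ≤
          √(∑ i, (√(GM.S a σ (wf n i)) * Gm z i - y i) ^ 2)
            + |GM.evolve a (n + 1) z (Fin.last n) - q| * (1 / (1 - a) ^ 2) := by
  obtain ⟨p, hp0, hpn, hrec, horth⟩ := dst n
  let μ : Fin n → ℝ := fun i => 1 + a ^ 2 - 2 * a * cos (wf n i)
  have h1a : 0 < (1 - a) ^ 2 := by have : 0 < 1 - a := by linarith
                                   positivity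
  have hμl : ∀ i, (1 - a) ^ 2 ≤ μ i := fun i => den_pos ha0 ha1 _
  have hμ : ∀ i, 0 < μ i := fun i => h1a.trans_le (hμl i)
  have he : ∀ i j, (1 + a ^ 2) * p i (j + 1) - a * p i j - a * p i (j + 2) = μ i * p i (j + 1) := by
    intro i j
    have := hrec i j
    simp only [μ]
    linear_combination (-a) * this
  have hsum : ∀ (i : Fin n) (U : ℕ → ℝ), ∑ j ∈ Finset.range (n + 1), p i (j + 1) * U (j + 1)
      = ∑ j ∈ Finset.range n, p i (j + 1) * U (j + 1) := by
    intro i U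
    rw [Finset.sum_range_succ, hpn]; simp
  let r : Fin n → Fin (n + 1) → ℝ := fun i j => (p i (j + 1) - a * p i j) / √(μ i)
  have hr : ∀ i k, ∑ j, r i j * r k j = if i = k then 1 else 0 := by
    intro i k
    have e := sbp a (μ i) (p i) (p k) (hp0 k) (he i) (n + 1)
    rw [hsum, horth, hpn k, mul_zero, add_zero] at e
    have : ∑ j, r i j * r k j = (∑ j ∈ Finset.range (n + 1), (p i (j + 1) - a * p i j) * (p k (j + 1) - a * p k j)) / (√(μ i) * √(μ k)) := by
      rw [Finset.sum_range, Finset.sum_div]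
      refine Finset.sum_congr rfl fun j _ => ?_
      simp only [r]
      rw [div_mul_div_comm]
    rw [this, e]
    split_ifs with h
    · subst h
      rw [← sq, Real.sq_sqrt (hμ i).le, mul_one, div_self (hμ i).ne']
    · simp
  -- orthogonality of columns
  let Pm : Matrix (Fin n) (Fin n) ℝ := Matrix.of fun i j => p i (j + 1)
  have hP1 : Pm * Pmᵀ = 1 := by
    ext i k
    rw [Matrix.mul_apply, Matrix.one_apply, ← horth, Finset.sum_range]
    rfl
  have hP2 : Pmᵀ * Pm = 1 := mul_eq_one_comm.1 hP1
  have hcol : ∀ j k : Fin n, ∑ i, p i (j + 1) * p i (k + 1) = if j = k then 1 else 0 := by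
    intro j k
    have := congrFun (congrFun hP2 j) k
    rw [Matrix.mul_apply, Matrix.one_apply] at this
    exact this
  have pars : ∀ u : Fin n → ℝ, ∑ j, u j ^ 2 = ∑ i, (∑ j : Fin n, p i (j + 1) * u j) ^ 2 := by
    intro u
    have : ∀ i, (∑ j : Fin n, p i (j + 1) * u j) ^ 2 = ∑ j : Fin n, ∑ k : Fin n, u j * u k * (p i (j + 1) * p i (k + 1)) := by
      intro i
      rw [sq, Finset.sum_mul_sum]
      refine Finset.sum_congr rfl fun j _ => Finset.sum_congr rfl fun k _ => by ring
    simp_rw [this]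
    rw [Finset.sum_comm]
    refine Finset.sum_congr rfl fun j _ => ?_
    rw [Finset.sum_comm]
    simp_rw [← Finset.mul_sum, hcol]
    simp [sq]
  let ω : Fin n → ℝ := fun i => a * p i (n + 2) / μ i
  have hω : √(∑ i, ω i ^ 2) ≤ 1 / (1 - a) ^ 2 := by
    apply Real.sqrt_le_iff.2
    refine ⟨by positivity, ?_⟩
    have h1 : ∑ i, p i n ^ 2 = 1 := by
      obtain ⟨m, rfl⟩ := Nat.exists_eq_succ_of_ne_zero hn.ne'
      have := hcol (Fin.last m) (Fin.last m)
      simp only [Fin.val_last, if_true] at this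
      rw [← this]
      exact Finset.sum_congr rfl fun i _ => by rw [sq]
    calc ∑ i, ω i ^ 2 ≤ ∑ i, (1 / (1 - a) ^ 2) ^ 2 * p i n ^ 2 := by
          refine Finset.sum_le_sum fun i _ => ?_
          have h2 : p i (n + 2) = - p i n := by
            have := hrec i n
            rw [hpn] at this; linarith
          have h3 : ω i ^ 2 = (a / μ i) ^ 2 * p i n ^ 2 := by
            simp only [ω]; rw [h2]; ring
          rw [h3]
          apply mul_le_mul_of_nonneg_right _ (sq_nonneg _)
          apply pow_le_pow_left₀ (div_nonneg ha0 (hμ i).le)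
          exact div_le_div₀ zero_le_one ha1.le h1a (hμl i)
      _ = _ := by rw [← Finset.mul_sum, h1, mul_one]
  refine ⟨fun z i => ∑ j, r i j * (z j / σ), fun y q j => ∑ i, p i (j + 1) * (y i - q * ω i), by fun_prop, ?_, ?_⟩
  · rw [gaussPi_eq σ hσ, Measure.map_map (by fun_prop) (by fun_prop), ← gam_map r hr]
    congr 1
    ext g i
    simp only [Function.comp]
    refine Finset.sum_congr rfl fun j _ => ?_
    field_simp
  · intro z y q
    let zz : ℕ → ℝ := fun j => if h : j < n + 1 then z ⟨j, h⟩ else 0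
    have hz1 : ∀ j : Fin (n + 1), z j = zz j := by
      intro j; simp only [zz]; rw [dif_pos j.2]
    have hz2 : ∀ j : Fin n, z j.castSucc = zz j := fun j => hz1 j.castSucc
    set U := Uext a zz with hU
    have hs : GM.evolve a (n + 1) z (Fin.last n) = U (n + 1) := by
      rw [evolve_eq a (n + 1) z zz hz1]; simp [hU]
    have hev : ∀ j : Fin n, GM.evolve a n (fun j => z j.castSucc) j = U (j + 1) :=
      fun j => evolve_eq a n _ zz hz2 j
    have hX : ∀ i, √(GM.S a σ (wf n i)) * ∑ j, r i j * (z j / σ)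
        = ∑ j : Fin n, p i (j + 1) * U (j + 1) + ω i * U (n + 1) := by
      intro i
      have e := sbp a (μ i) (p i) U rfl (he i) (n + 1)
      rw [hsum, hpn i, mul_zero, sub_zero, Finset.sum_range, Finset.sum_range] at e
      have e2 : ∑ j, r i j * (z j / σ) = (∑ j : Fin (n + 1), (p i (j + 1) - a * p i j) * (U (j + 1) - a * U j)) / (σ * √(μ i)) := by
        rw [Finset.sum_div]
        refine Finset.sum_congr rfl fun j _ => ?_
        rw [hU, Uext_rec, hz1]
        simp only [r]
        rw [div_mul_div_comm, mul_comm σ]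
      rw [e2, e]
      have e3 : √(GM.S a σ (wf n i)) = σ / √(μ i) := by
        unfold GM.S
        rw [Real.sqrt_div (sq_nonneg _), Real.sqrt_sq hσ.le]
      rw [e3]
      simp only [ω]
      have h4 := (Real.sqrt_pos.2 (hμ i)).ne'
      have h5 : √(μ i) * √(μ i) = μ i := Real.mul_self_sqrt (hμ i).le
      have h6 := (hμ i).ne'
      rw [div_mul_div_comm, show √(μ i) * (σ * √(μ i)) = σ * (√(μ i) * √(μ i)) by ring, h5]
      field_simp
    simp_rw [hX, hs, hev]
    rw [pars]
    have hco : ∀ i, ∑ j : Fin n, p i (j + 1) * (U (j + 1) - ∑ k, p k (j + 1) * (y k - q * ω k))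
        = (∑ j : Fin n, p i (j + 1) * U (j + 1) + ω i * U (n + 1) - y i) + (-(U (n + 1) - q)) * ω i := by
      intro i
      simp_rw [mul_sub, Finset.sum_sub_distrib]
      have : ∑ j : Fin n, p i (j + 1) * ∑ k, (p k (j + 1) * y k - p k (j + 1) * (q * ω k)) = y i - q * ω i := by
        have : ∀ j : Fin n, p i (j + 1) * ∑ k, (p k (j + 1) * y k - p k (j + 1) * (q * ω k)) =
          ∑ k, (p i (j + 1) * p k (j + 1)) * (y k - q * ω k) := by
          intro j; rw [Finset.mul_sum]; exact Finset.sum_congr rfl fun k _ => by ring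
        simp_rw [this]
        rw [Finset.sum_comm]
        have h7 : ∀ k, ∑ j : Fin n, p i (j + 1) * p k (j + 1) = if i = k then 1 else 0 := by
          intro k; rw [← horth, Finset.sum_range]
        simp_rw [← Finset.sum_mul, h7]
        simp
      simp_rw [Finset.sum_sub_distrib] at this
      rw [this]; ring
    simp_rw [hco]
    refine (minkowski _ _).trans ?_
    gcongr
    simp_rw [mul_pow]
    rw [← Finset.mul_sum, Real.sqrt_mul (sq_nonneg _), Real.sqrt_sq_eq_abs, abs_neg]
    gcongr

lemma stail {a σ : ℝ} (ha0 : 0 ≤ a) (ha1 : a < 1) (hσ : 0 < σ) (n : ℕ) (hn : 0 < n) :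
    (GM.gaussPi σ (n + 1)).real {z | (n : ℝ) ^ 2 ≤ |GM.evolve a (n + 1) z (Fin.last n)|}
      ≤ 2 * σ * (∫ y, |y| ^ 1 ∂(gaussianReal 0 1)) / n := by
  have hn1 : (1:ℝ) ≤ n := by exact_mod_cast hn
  have hmeas : Measurable fun z : Fin (n + 1) → ℝ => GM.evolve a (n + 1) z (Fin.last n) := by
    unfold GM.evolve; fun_prop
  rw [gaussPi_eq σ hσ, map_measureReal_apply (by fun_prop)
    (measurableSet_le measurable_const (by exact hmeas.abs))]
  have hI : Integrable (fun g : Fin (n + 1) → ℝ => ∑ j, σ * |g j| ^ 1) (gam (n + 1)) :=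
    integrable_finsetSum _ fun j _ => (pi_integrable j (fun y => |y| ^ 1) (gint 1 1)).const_mul _
  have M := mul_meas_ge_le_integral_of_nonneg (μ := gam (n + 1)) (f := fun g : Fin (n + 1) → ℝ => ∑ j, σ * |g j| ^ 1)
    (ae_of_all _ fun g => by positivity) hI ((n:ℝ) ^ 2)
  have e : ∫ g, ∑ j : Fin (n + 1), σ * |g j| ^ 1 ∂(gam (n + 1)) = (n + 1) * σ * (∫ y, |y| ^ 1 ∂(gaussianReal 0 1)) := by
    rw [integral_finsetSum _ (fun j _ => (pi_integrable j (fun y => |y| ^ 1) (gint 1 1)).const_mul _)]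
    simp_rw [integral_const_mul]
    have : ∀ j : Fin (n + 1), ∫ g, |g j| ^ 1 ∂(gam (n + 1)) = ∫ y, |y| ^ 1 ∂(gaussianReal 0 1) :=
      fun j => pi_int j (fun y => |y| ^ 1) (by fun_prop)
    simp_rw [this]
    simp; ring
  rw [e] at M
  have hc : 0 ≤ ∫ y : ℝ, |y| ^ 1 ∂(gaussianReal 0 1) := integral_nonneg fun y => by positivity
  have hsub : (gam (n + 1)).real ((fun g i => σ * g i) ⁻¹' {z | (n : ℝ) ^ 2 ≤ |GM.evolve a (n + 1) z (Fin.last n)|})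
      ≤ (gam (n + 1)).real {g | (n : ℝ) ^ 2 ≤ ∑ j, σ * |g j| ^ 1} := by
    refine measureReal_mono fun g hg => ?_
    simp only [Set.mem_preimage, Set.mem_ofPred_eq] at hg ⊢
    refine hg.trans ?_
    unfold GM.evolve
    refine (Finset.abs_sum_le_sum_abs _ _).trans ?_
    refine (Finset.sum_le_sum_of_subset_of_nonneg (Finset.subset_univ _) (fun _ _ _ => abs_nonneg _)).trans ?_
    refine Finset.sum_le_sum fun j _ => ?_
    rw [abs_mul, abs_mul, abs_of_pos hσ, pow_one, abs_of_nonneg (pow_nonneg ha0 _)]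
    exact mul_le_of_le_one_left (by positivity) (pow_le_one₀ ha0 ha1.le)
  refine hsub.trans ?_
  rw [le_div_iff₀ (by linarith)]
  set Pq := (gam (n + 1)).real {g | (n : ℝ) ^ 2 ≤ ∑ j, σ * |g j| ^ 1}
  have h9 : (n:ℝ) * (Pq * n) ≤ n * (2 * σ * ∫ y : ℝ, |y| ^ 1 ∂(gaussianReal 0 1)) := by
    have h10 : 0 ≤ σ * ∫ y : ℝ, |y| ^ 1 ∂(gaussianReal 0 1) := by positivity
    nlinarith
  exact le_of_mul_le_mul_left h9 (by linarith)

end GMX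
end

section
namespace GMX


lemma riem (h : ℝ → ℝ) (L : ℝ) (he : ∀ x, h (-x) = h x) (hL : ∀ x y, |h x - h y| ≤ L * |x - y|)
    (hc : Continuous h) :
    ∃ C, ∀ n : ℕ, |∑ i : Fin n, h (wf n i) - n * ((1 / (2 * π)) * ∫ w in Set.Icc (-π) π, h w)| ≤ C := by
  have hpi := pi_pos
  have e0 : ∫ w in Set.Icc (-π) π, h w = 2 * ∫ w in (0:ℝ)..π, h w := by
    rw [integral_Icc_eq_integral_Ioc, ← intervalIntegral.integral_of_le (by linarith),
      ← intervalIntegral.integral_add_adjacent_intervals (hc.intervalIntegrable (-π) 0) (hc.intervalIntegrable 0 π)]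
    have : ∫ w in (-π)..0, h w = ∫ w in (0:ℝ)..π, h w := by
      have := intervalIntegral.integral_comp_neg (a := 0) (b := π) h
      simp only [he, neg_zero] at this
      exact this.symm
    rw [this]; ring
  set I := ∫ w in (0:ℝ)..π, h w with hI
  refine ⟨L * π + |h π| + |I| / π, fun n => ?_⟩
  set N : ℝ := n + 1 with hN
  have hNp : 0 < N := by positivity
  have hs : ∑ k ∈ Finset.range (n + 1), ∫ w in ((k:ℕ) * (π / N))..((k + 1 : ℕ) * (π / N)), h w = I := by
    rw [intervalIntegral.sum_integral_adjacent_intervals (a := fun k : ℕ => (k:ℝ) * (π / N))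
      (fun k _ => hc.intervalIntegrable _ _)]
    rw [hI]
    congr 1
    · simp
    · rw [hN]; push_cast; field_simp
  have hp : ∀ k ∈ Finset.range (n + 1), |(∫ w in ((k:ℕ) * (π / N))..((k + 1 : ℕ) * (π / N)), h w) - (π / N) * h ((k + 1 : ℕ) * (π / N))| ≤ L * (π / N) * (π / N) := by
    intro k _
    have hd : 0 < π / N := by positivity
    have e1 : (π / N) * h ((k + 1 : ℕ) * (π / N)) = ∫ w in ((k:ℕ) * (π / N))..((k + 1 : ℕ) * (π / N)), h ((k + 1 : ℕ) * (π / N)) := by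
      rw [intervalIntegral.integral_const, smul_eq_mul]; push_cast; ring
    rw [e1, ← intervalIntegral.integral_sub (hc.intervalIntegrable _ _) (by simp)]
    have := intervalIntegral.norm_integral_le_of_norm_le_const (a := (k:ℕ) * (π / N)) (b := (k + 1 : ℕ) * (π / N))
      (f := fun w => h w - h ((k + 1 : ℕ) * (π / N))) (C := L * (π / N)) ?_
    · rw [Real.norm_eq_abs] at this
      refine this.trans (le_of_eq ?_)
      rw [abs_of_pos (by push_cast; linarith)]; push_cast; ring
    · intro x hx
      rw [Set.uIoc_of_le (by push_cast; linarith)] at hx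
      have h2 : |x - (k + 1 : ℕ) * (π / N)| ≤ π / N := by
        rw [abs_le]; push_cast at hx ⊢; constructor <;> linarith [hx.1, hx.2]
      have hL0 : 0 ≤ L := by have q1 := hL 1 0
                             rw [sub_zero, abs_one, mul_one] at q1
                             exact (abs_nonneg _).trans q1
      rw [Real.norm_eq_abs]
      exact (hL _ _).trans (mul_le_mul_of_nonneg_left h2 hL0)
  have hsum := (Finset.abs_sum_le_sum_abs _ _).trans (Finset.sum_le_sum hp)
  rw [Finset.sum_sub_distrib, hs, ← Finset.mul_sum, Finset.sum_range_succ, Finset.sum_const, Finset.card_range, nsmul_eq_mul] at hsum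
  have e2 : ∑ k ∈ Finset.range n, h ((k + 1 : ℕ) * (π / N)) = ∑ i : Fin n, h (wf n i) := by
    rw [Finset.sum_range]
    refine Finset.sum_congr rfl fun i _ => ?_
    unfold wf; push_cast; rw [hN, mul_div_assoc]
  have e3 : ((n + 1 : ℕ) : ℝ) * (π / N) = π := by rw [hN]; push_cast; field_simp
  rw [e2, e3, ← mul_assoc, mul_comm L, ← mul_assoc, e3] at hsum
  rw [e0]
  set T := ∑ i : Fin n, h (wf n i)
  have e4 : T - n * (1 / (2 * π) * (2 * I)) = -(N / π) * (I - π / N * (T + h π)) - h π + I / π := by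
    rw [hN]; field_simp; ring
  rw [e4]
  refine (abs_add_le _ _).trans (add_le_add ((abs_sub _ _).trans (add_le_add_left ?_ _)) ?_)
  · rw [abs_mul, abs_neg, abs_of_pos (by positivity)]
    calc N / π * |I - π / N * (T + h π)| ≤ N / π * (π * L * (π / N)) := by gcongr
      _ = L * π := by field_simp
  · rw [abs_div, abs_of_pos hpi]

lemma poisson {a : ℝ} (ha0 : 0 ≤ a) (ha1 : a < 1) (σ : ℝ) :
    ∫ w in Set.Icc (-π) π, GM.S a σ w = 2 * π * (σ ^ 2 / (1 - a ^ 2)) := by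
  have hpi := pi_pos
  have h1 : 0 < 1 - a ^ 2 := by nlinarith
  have K := DiffContOnCl.circleAverage_poissonKernel_smul' (f := fun _ : ℂ => (1:ℂ)) (c := 0) (R := 1) (w := (a:ℂ))
    diffContOnCl_const (by simp [abs_of_nonneg ha0, ha1])
  rw [circleAverage_def] at K
  have e : ∀ t : ℝ, ((‖circleMap 0 1 t - 0‖ ^ 2 - ‖(a:ℂ) - 0‖ ^ 2) / ‖(circleMap 0 1 t - 0) - ((a:ℂ) - 0)‖ ^ 2) • (1:ℂ)
      = (((1 - a ^ 2) / (1 + a ^ 2 - 2 * a * cos t) : ℝ) : ℂ) := by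
    intro t
    have e1 : ‖circleMap 0 1 t - 0‖ = 1 := by simp
    have e2 : ‖(a:ℂ) - 0‖ ^ 2 = a ^ 2 := by simp
    have e3 : ‖(circleMap 0 1 t - 0) - ((a:ℂ) - 0)‖ ^ 2 = 1 + a ^ 2 - 2 * a * cos t := by
      rw [← Complex.normSq_eq_norm_sq, sub_zero, sub_zero]
      simp only [circleMap, Complex.normSq_apply]
      simp [Complex.exp_ofReal_mul_I_re, Complex.exp_ofReal_mul_I_im]
      nlinarith [sin_sq_add_cos_sq t]
    rw [e1, e2, e3]
    simp
  simp_rw [e] at K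
  rw [intervalIntegral.integral_ofReal] at K
  have K2 : ∫ t in (0:ℝ)..2 * π, (1 - a ^ 2) / (1 + a ^ 2 - 2 * a * cos t) = 2 * π := by
    rw [Complex.real_smul] at K
    have : (2 * π)⁻¹ * ∫ t in (0:ℝ)..2 * π, (1 - a ^ 2) / (1 + a ^ 2 - 2 * a * cos t) = 1 := by exact_mod_cast K
    field_simp at this
    linarith
  have K3 : ∫ t in (-π)..(-π + 2 * π), (1 - a ^ 2) / (1 + a ^ 2 - 2 * a * cos t) = 2 * π := by
    have := Function.Periodic.intervalIntegral_add_eq (f := fun t => (1 - a ^ 2) / (1 + a ^ 2 - 2 * a * cos t)) (T := 2 * π)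
      (fun t => by simp) (-π) 0
    rw [this, zero_add, K2]
  rw [integral_Icc_eq_integral_Ioc, ← intervalIntegral.integral_of_le (by linarith)]
  rw [show -π + 2 * π = π by ring] at K3
  have : ∀ w, GM.S a σ w = (σ ^ 2 / (1 - a ^ 2)) * ((1 - a ^ 2) / (1 + a ^ 2 - 2 * a * cos w)) := by
    intro w; unfold GM.S; field_simp
  simp_rw [this]
  rw [intervalIntegral.integral_const_mul, K3]; ring

lemma S_pos {a σ : ℝ} (ha0 : 0 ≤ a) (ha1 : a < 1) (hσ : 0 < σ) (w : ℝ) : 0 < GM.S a σ w := by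
  have := den_pos ha0 ha1 w
  have : 0 < (1 - a) ^ 2 := pow_pos (by linarith) 2
  unfold GM.S; apply div_pos (by positivity); linarith

lemma S_le {a σ : ℝ} (ha0 : 0 ≤ a) (ha1 : a < 1) (w : ℝ) : GM.S a σ w ≤ σ ^ 2 / (1 - a) ^ 2 := by
  have := den_pos ha0 ha1 w
  have : 0 < (1 - a) ^ 2 := pow_pos (by linarith) 2
  unfold GM.S; gcongr

lemma S_cont {a : ℝ} (ha0 : 0 ≤ a) (ha1 : a < 1) (σ : ℝ) : Continuous (GM.S a σ) := by
  unfold GM.S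
  refine Continuous.div (by fun_prop) (by fun_prop) fun w => ?_
  have := den_pos ha0 ha1 w
  have : 0 < (1 - a) ^ 2 := pow_pos (by linarith) 2
  linarith

lemma S_lip {a : ℝ} (ha0 : 0 ≤ a) (ha1 : a < 1) (σ : ℝ) :
    ∃ L, 0 ≤ L ∧ ∀ x y, |GM.S a σ x - GM.S a σ y| ≤ L * |x - y| := by
  have h2 : 0 < (1 - a) ^ 2 := pow_pos (by linarith) 2
  refine ⟨σ ^ 2 * (2 * a) / ((1 - a) ^ 2 * (1 - a) ^ 2), by positivity, fun x y => ?_⟩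
  have hx := den_pos ha0 ha1 x
  have hy := den_pos ha0 ha1 y
  have hx' := h2.trans_le hx
  have hy' := h2.trans_le hy
  have e : GM.S a σ x - GM.S a σ y = σ ^ 2 * (2 * a) * (cos x - cos y) / ((1 + a ^ 2 - 2 * a * cos x) * (1 + a ^ 2 - 2 * a * cos y)) := by
    unfold GM.S; rw [div_sub_div _ _ hx'.ne' hy'.ne']; congr 1; ring
  rw [e, abs_div, abs_mul, abs_of_pos (mul_pos hx' hy'), abs_of_nonneg (by positivity : 0 ≤ σ ^ 2 * (2 * a)), div_mul_eq_mul_div]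
  have : |cos x - cos y| ≤ |x - y| := abs_cos_sub_cos_le x y
  gcongr

lemma riemS {a σ : ℝ} (ha0 : 0 ≤ a) (ha1 : a < 1) (hσ : 0 < σ) (f : ℝ → ℝ) (L : ℝ) (hL : 0 ≤ L)
    (hf : ∀ s t, 0 < s → 0 < t → s ≤ σ ^ 2 / (1 - a) ^ 2 → t ≤ σ ^ 2 / (1 - a) ^ 2 → |f s - f t| ≤ L * |s - t|) :
    Continuous (fun w => f (GM.S a σ w)) ∧
    ∃ C, ∀ n : ℕ, |∑ i : Fin n, f (GM.S a σ (wf n i)) - n * ((1 / (2 * π)) * ∫ w in Set.Icc (-π) π, f (GM.S a σ w))| ≤ C := by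
  obtain ⟨L2, hL2, h2⟩ := S_lip ha0 ha1 σ
  have key : ∀ x y, |f (GM.S a σ x) - f (GM.S a σ y)| ≤ (L * L2) * |x - y| := by
    intro x y
    refine (hf _ _ (S_pos ha0 ha1 hσ x) (S_pos ha0 ha1 hσ y) (S_le ha0 ha1 x) (S_le ha0 ha1 y)).trans ?_
    rw [mul_assoc]
    exact mul_le_mul_of_nonneg_left (h2 x y) hL
  have hc : Continuous (fun w => f (GM.S a σ w)) := by
    have : LipschitzWith (Real.toNNReal (L * L2)) (fun w => f (GM.S a σ w)) := by
      refine LipschitzWith.of_dist_le_mul fun x y => ?_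
      rw [Real.dist_eq, Real.dist_eq, Real.coe_toNNReal _ (by positivity)]
      exact key x y
    exact this.continuous
  exact ⟨hc, riem _ _ (fun x => by simp [GM.S]) key hc⟩

end GMX
end

section
namespace GMX


lemma sqlip {K x y : ℝ} (hx : |x| ≤ K) (hy : |y| ≤ K) : |x ^ 2 - y ^ 2| ≤ 2 * K * |x - y| := by
  rw [show x ^ 2 - y ^ 2 = (x + y) * (x - y) by ring, abs_mul]
  have := abs_add_le x y
  gcongr; linarith

lemma min1_sq {s : ℝ} (hs : 0 ≤ s) : min 1 (s ^ 2) = (min 1 s) ^ 2 := by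
  rcases le_total 1 s with h | h
  · rw [min_eq_left h, min_eq_left (by nlinarith)]; ring
  · rw [min_eq_right h, min_eq_right (by nlinarith)]

lemma logmax {s θ : ℝ} (hs : 0 < s) (hθ : 0 < θ) : max 0 ((1 / 2) * log (s / θ)) = 1 / 2 * log (max s θ) - 1 / 2 * log θ := by
  rw [log_div hs.ne' hθ.ne']
  rcases le_total s θ with h | h
  · have := log_le_log hs h
    rw [max_eq_right h, max_eq_left (by linarith)]; ring
  · have := log_le_log hθ h
    rw [max_eq_left h, max_eq_right (by linarith)]; ring

lemma loglip {θ s t : ℝ} (hθ : 0 < θ) (hs : θ ≤ s) (ht : θ ≤ t) : |log s - log t| ≤ 1 / θ * |s - t| := by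
  wlog h : t ≤ s generalizing s t
  · rw [abs_sub_comm, abs_sub_comm s]; exact this ht hs (le_of_not_ge h)
  have ht0 := hθ.trans_le ht
  have hs0 := hθ.trans_le hs
  rw [abs_of_nonneg (sub_nonneg.2 (log_le_log ht0 h)), abs_of_nonneg (sub_nonneg.2 h), ← log_div hs0.ne' ht0.ne']
  refine (log_le_sub_one_of_pos (div_pos hs0 ht0)).trans ?_
  rw [show s / t - 1 = (1 / t) * (s - t) by field_simp]
  have : 0 ≤ s - t := sub_nonneg.2 h
  gcongr

lemma spec {a σ d θ : ℝ} (ha0 : 0 ≤ a) (ha1 : a < 1) (hσ : 0 < σ) (hdmax : d < σ ^ 2 / (1 - a ^ 2))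
    (hθ : 0 < θ) (hwater : GM.waterEq a σ θ d) :
    ∃ C c : ℝ, 0 < c ∧ 0 < GM.VU a σ θ ∧ ∀ n : ℕ,
      |∑ i : Fin n, min θ (GM.S a σ (wf n i)) - n * d| ≤ C ∧
      |∑ i : Fin n, max 0 ((1 / 2) * log (GM.S a σ (wf n i) / θ)) - n * GM.RU a σ θ| ≤ C ∧
      |∑ i : Fin n, (min 1 (GM.S a σ (wf n i) / θ)) ^ 2 / 2 - n * GM.VU a σ θ| ≤ C ∧
      2 * c * n - C ≤ ∑ i : Fin n, (max (GM.S a σ (wf n i) - θ) 0) ^ 2 := by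
  have hpi := pi_pos
  obtain ⟨K, hK⟩ : ∃ K, K = σ ^ 2 / (1 - a) ^ 2 := ⟨_, rfl⟩
  have hK0 : 0 ≤ K := by rw [hK]; positivity
  have hmm : ∀ x y z : ℝ, |min z x - min z y| ≤ |x - y| := fun x y z => by
    refine (abs_min_sub_min_le_max z x z y).trans ?_; simp
  have hMM : ∀ x y z : ℝ, |max x z - max y z| ≤ |x - y| := fun x y z => by
    refine (abs_max_sub_max_le_max x z y z).trans ?_; simp
  obtain ⟨-, C1, h1⟩ := riemS ha0 ha1 hσ (fun s => min θ s) 1 zero_le_one (fun s t _ _ _ _ => by rw [one_mul]; exact hmm s t θ)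
  obtain ⟨-, C2, h2⟩ := riemS ha0 ha1 hσ (fun s => max 0 ((1 / 2) * log (s / θ))) (1 / θ) (by positivity) (fun s t hs ht _ _ => by
    rw [logmax hs hθ, logmax ht hθ]
    have q := loglip hθ (le_max_right s θ) (le_max_right t θ)
    have q2 := (q.trans (mul_le_mul_of_nonneg_left (hMM s t θ) (by positivity)))
    rw [show 1 / 2 * log (max s θ) - 1 / 2 * log θ - (1 / 2 * log (max t θ) - 1 / 2 * log θ) = 1 / 2 * (log (max s θ) - log (max t θ)) by ring, abs_mul,
      abs_of_pos (by norm_num : (0:ℝ) < 1 / 2)]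
    have := abs_nonneg (log (max s θ) - log (max t θ))
    linarith)
  obtain ⟨c3, C3, h3⟩ := riemS ha0 ha1 hσ (fun s => min 1 ((s / θ) ^ 2)) (2 * 1 * (1 / θ)) (by positivity) (fun s t hs ht _ _ => by
    have hs' : 0 < s / θ := div_pos hs hθ
    have ht' : 0 < t / θ := div_pos ht hθ
    rw [min1_sq hs'.le, min1_sq ht'.le]
    refine (sqlip (K := 1) ?_ ?_).trans ?_
    · rw [abs_of_pos (lt_min one_pos hs')]; exact min_le_left _ _
    · rw [abs_of_pos (lt_min one_pos ht')]; exact min_le_left _ _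
    · rw [mul_assoc (2 * 1)]
      refine mul_le_mul_of_nonneg_left ((hmm _ _ _).trans (le_of_eq ?_)) (by norm_num)
      rw [← sub_div, abs_div, abs_of_pos hθ]; ring)
  obtain ⟨c4, C4, h4⟩ := riemS ha0 ha1 hσ (fun s => (max (s - θ) 0) ^ 2) (2 * K) (by positivity) (fun s t hs ht hsK htK => by
    rw [← hK] at hsK htK
    have q : ∀ u : ℝ, 0 < u → u ≤ K → |max (u - θ) 0| ≤ K := fun u h0 h => by
      rw [abs_of_nonneg (le_max_right _ _)]; apply max_le <;> linarith
    refine (sqlip (q s hs hsK) (q t ht htK)).trans ?_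
    refine mul_le_mul_of_nonneg_left ((hMM _ _ _).trans (le_of_eq ?_)) (by positivity)
    congr 1; ring)
  have hlt : θ < GM.S a σ 0 := by
    by_contra hcon
    push Not at hcon
    have hall : ∀ w, min θ (GM.S a σ w) = GM.S a σ w := fun w => min_eq_right (by
      refine (S_le ha0 ha1 w).trans (le_trans (le_of_eq ?_) hcon)
      unfold GM.S; rw [cos_zero]; congr 1; ring)
    unfold GM.waterEq at hwater
    simp_rw [hall] at hwater
    rw [poisson ha0 ha1] at hwater
    have : d = σ ^ 2 / (1 - a ^ 2) := by rw [hwater]; field_simp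
    linarith
  obtain ⟨I4, hI4⟩ : ∃ I4, I4 = ∫ w in Set.Icc (-π) π, (max (GM.S a σ w - θ) 0) ^ 2 := ⟨_, rfl⟩
  have hI4p : 0 < I4 := by
    rw [hI4, integral_Icc_eq_integral_Ioc, ← intervalIntegral.integral_of_le (by linarith)]
    refine intervalIntegral.integral_pos (by linarith) c4.continuousOn (fun x _ => sq_nonneg _) ⟨0, ⟨by linarith, by linarith⟩, ?_⟩
    have : 0 < max (GM.S a σ 0 - θ) 0 := lt_max_of_lt_left (by linarith)
    positivity
  have hVp : 0 < GM.VU a σ θ := by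
    unfold GM.VU
    refine mul_pos (by positivity) ?_
    rw [integral_Icc_eq_integral_Ioc, ← intervalIntegral.integral_of_le (by linarith)]
    refine intervalIntegral.integral_pos (by linarith) c3.continuousOn (fun x _ => ?_) ⟨0, ⟨by linarith, by linarith⟩, ?_⟩
    · exact le_min zero_le_one (sq_nonneg _)
    · have := S_pos ha0 ha1 hσ 0
      exact lt_min one_pos (by positivity)
  obtain ⟨M, q1, q2, q3, q4⟩ : ∃ M, C1 ≤ M ∧ C2 ≤ M ∧ C3 ≤ M ∧ C4 ≤ M :=
    ⟨max (max C1 C2) (max C3 C4), by simp, by simp, by simp, by simp⟩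
  refine ⟨M, (1 / (2 * π)) * I4 / 2, by positivity, hVp, fun n => ?_⟩
  refine ⟨?_, (h2 n).trans q2, ?_, ?_⟩
  · unfold GM.waterEq at hwater
    rw [hwater]
    exact (h1 n).trans q1
  · have := h3 n
    have e : ∑ i : Fin n, (min 1 (GM.S a σ (wf n i) / θ)) ^ 2 / 2 - n * GM.VU a σ θ
        = (∑ i : Fin n, min 1 ((GM.S a σ (wf n i) / θ) ^ 2) - n * ((1 / (2 * π)) * ∫ w in Set.Icc (-π) π, min 1 ((GM.S a σ w / θ) ^ 2))) / 2 := by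
      rw [← Finset.sum_div]
      unfold GM.VU
      have : ∀ i : Fin n, min 1 ((GM.S a σ (wf n i) / θ) ^ 2) = (min 1 (GM.S a σ (wf n i) / θ)) ^ 2 := fun i =>
        min1_sq (div_pos (S_pos ha0 ha1 hσ _) hθ).le
      simp_rw [this]
      ring
    rw [e, abs_div, abs_of_pos (by norm_num : (0:ℝ) < 2)]
    have h5 := abs_nonneg (∑ i : Fin n, min 1 ((GM.S a σ (wf n i) / θ) ^ 2) - n * ((1 / (2 * π)) * ∫ w in Set.Icc (-π) π, min 1 ((GM.S a σ w / θ) ^ 2)))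
    linarith
  · have := (abs_le.1 (h4 n)).1
    rw [← hI4] at this
    have e : 2 * ((1 / (2 * π)) * I4 / 2) * n = n * (1 / (2 * π) * I4) := by ring
    rw [e]; linarith

end GMX
end

section
namespace GMX


lemma g4 : ∫ y, y ^ 4 ∂(gaussianReal 0 1) = 3 := by
  have hI : (0:ℝ) ∈ interior (integrableExpSet id (gaussianReal 0 1)) := by
    rw [integrableExpSet_id_gaussianReal]; simp
  have := iteratedDeriv_mgf_zero hI 4
  rw [mgf_id_gaussianReal] at this
  have e0 : (fun t : ℝ => rexp (0 * t + ((1:ℝ≥0):ℝ) * t ^ 2 / 2)) = fun t => rexp (t ^ 2 / 2) := by ext; simp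
  rw [e0] at this
  have hE : ∀ t : ℝ, HasDerivAt (fun t => rexp (t ^ 2 / 2)) (rexp (t ^ 2 / 2) * t) t := by
    intro t
    have := ((hasDerivAt_pow 2 t).div_const 2).exp
    convert this using 1; simp
  have d1 : deriv (fun t : ℝ => rexp (t ^ 2 / 2)) = fun t => t * rexp (t ^ 2 / 2) :=
    funext fun t => by rw [(hE t).deriv]; ring
  have d2 : deriv (fun t : ℝ => t * rexp (t ^ 2 / 2)) = fun t => (1 + t ^ 2) * rexp (t ^ 2 / 2) :=
    funext fun t => by rw [show (fun t : ℝ => t * rexp (t ^ 2 / 2)) = (fun t => t) * fun t => rexp (t ^ 2 / 2) from rfl, ((hasDerivAt_id' t).mul (hE t)).deriv]; ring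
  have d3 : deriv (fun t : ℝ => (1 + t ^ 2) * rexp (t ^ 2 / 2)) = fun t => (3 * t + t ^ 3) * rexp (t ^ 2 / 2) :=
    funext fun t => by rw [show (fun t : ℝ => (1 + t ^ 2) * rexp (t ^ 2 / 2)) = (fun t => 1 + t ^ 2) * fun t => rexp (t ^ 2 / 2) from rfl, (((hasDerivAt_pow 2 t).const_add 1).mul (hE t)).deriv]; push_cast; ring
  have d4 : deriv (fun t : ℝ => (3 * t + t ^ 3) * rexp (t ^ 2 / 2)) = fun t => (3 + 6 * t ^ 2 + t ^ 4) * rexp (t ^ 2 / 2) :=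
    funext fun t => by rw [show (fun t : ℝ => (3 * t + t ^ 3) * rexp (t ^ 2 / 2)) = ((fun t => 3 * t) + fun t => t ^ 3) * fun t => rexp (t ^ 2 / 2) from rfl, ((((hasDerivAt_id' t).const_mul 3).add (hasDerivAt_pow 3 t)).mul (hE t)).deriv]; simp only [Pi.add_apply]; push_cast; ring
  rw [iteratedDeriv_succ', d1, iteratedDeriv_succ', d2, iteratedDeriv_succ', d3, iteratedDeriv_succ', d4, iteratedDeriv_zero] at this
  simp at this
  rw [this]

def ee (g : ℝ) : ℝ := g ^ 2 - 1

lemma ee_meas : Measurable ee := by unfold ee; fun_prop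

lemma ee_qX : ee = qX 0 1 := by ext g; unfold ee qX; ring

lemma ee_mean : ∫ g, ee g ∂(gaussianReal 0 1) = 0 := by rw [ee_qX, qX_mean]

lemma ee_int (k : ℕ) : Integrable (fun g => |ee g| ^ k) (gaussianReal 0 1) := by
  rw [ee_qX]
  exact (qX_pow (b := 0) (s := 1) (x := 0) (K0 := 1) le_rfl zero_le_one (by norm_num) k).1

lemma ee_var : ∫ g, ee g ^ 2 ∂(gaussianReal 0 1) = 2 := by
  have e : ∀ g : ℝ, ee g ^ 2 = g ^ 4 - (2 * g ^ 2 - 1) := fun g => by unfold ee; ring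
  have i2 : Integrable (fun g : ℝ => g ^ 2) (gaussianReal 0 1) := (gint 1 2).congr (ae_of_all _ fun g => by simp)
  have i4 : Integrable (fun g : ℝ => g ^ 4) (gaussianReal 0 1) := (gint 1 4).congr (ae_of_all _ fun g => by
    simp only; rw [← abs_pow, abs_of_nonneg (by positivity)])
  have i3 : Integrable (fun g : ℝ => 2 * g ^ 2 - 1) (gaussianReal 0 1) := (i2.const_mul 2).sub (integrable_const _)
  simp_rw [e]
  rw [integral_sub i4 i3, integral_sub (i2.const_mul 2) (integrable_const _),
    integral_const_mul, g2, g4]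
  simp; norm_num

lemma ee_memLp : MemLp ee 2 (gaussianReal 0 1) := by
  rw [memLp_two_iff_integrable_sq ee_meas.aestronglyMeasurable]
  exact (ee_int 2).congr (ae_of_all _ fun g => by simp)

lemma cheb {n : ℕ} (κ : Fin n → ℝ) {K r : ℝ} (hκ : ∀ i, |κ i| ≤ K) (hr : 0 < r) :
    (gam n).real {g | r ≤ |∑ i, κ i * ee (g i)|} ≤ 2 * K ^ 2 * n / r ^ 2 := by
  have hm : ∀ i, MemLp (fun g => κ i * ee g) 2 (gaussianReal 0 1) := fun i => ee_memLp.const_mul _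
  have hm' : ∀ i, MemLp (fun g : Fin n → ℝ => κ i * ee (g i)) 2 (gam n) := fun i =>
    (hm i).comp_measurePreserving (measurePreserving_eval (fun _ : Fin n => gaussianReal 0 1) i)
  have hv := variance_sum_pi (μ := fun _ : Fin n => gaussianReal 0 1) (X := fun i g => κ i * ee g) hm
  have hs : MemLp (∑ i, fun g : Fin n → ℝ => κ i * ee (g i)) 2 (gam n) := memLp_finsetSum' _ fun i _ => hm' i
  have M := meas_ge_le_variance_div_sq hs hr
  have mean : ∫ g, (∑ i, fun g : Fin n → ℝ => κ i * ee (g i)) g ∂(gam n) = 0 := by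
    simp only [Finset.sum_apply]
    rw [integral_finsetSum _ fun i _ => (hm' i).integrable (by norm_num)]
    refine Finset.sum_eq_zero fun i _ => ?_
    rw [integral_const_mul, pi_int i ee ee_meas, ee_mean, mul_zero]
  rw [mean, hv] at M
  simp only [Finset.sum_apply, sub_zero] at M
  have hb : ∑ i, variance (fun g => κ i * ee g) (gaussianReal 0 1) ≤ 2 * K ^ 2 * n := by
    calc _ ≤ ∑ i : Fin n, 2 * K ^ 2 := by
          refine Finset.sum_le_sum fun i _ => ?_
          rw [variance_const_mul, variance_of_integral_eq_zero ee_meas.aemeasurable ee_mean, ee_var, ← sq_abs, mul_comm]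
          have := pow_le_pow_left₀ (abs_nonneg _) (hκ i) 2
          linarith
      _ = _ := by simp; ring
  refine ENNReal.toReal_le_of_le_ofReal (by positivity) (M.trans (ENNReal.ofReal_le_ofReal ?_))
  gcongr

lemma mark3 {n : ℕ} (l : Fin n → ℝ) {K r : ℝ} (hK : ∀ i, l i ≤ K) (hr : 0 < r) :
    (gam n).real {g | r ≤ ∑ i, |√(l i) * g i| ^ 3} ≤ √K ^ 3 * c3 * n / r := by
  have e : ∀ g : Fin n → ℝ, ∑ i, |√(l i) * g i| ^ 3 = ∑ i, √(l i) ^ 3 * |g i| ^ 3 := fun g => by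
    refine Finset.sum_congr rfl fun i _ => ?_
    rw [abs_mul, mul_pow, abs_of_nonneg (Real.sqrt_nonneg _)]
  simp_rw [e]
  have hi : ∀ i, Integrable (fun g : Fin n → ℝ => √(l i) ^ 3 * |g i| ^ 3) (gam n) := fun i =>
    (pi_integrable i (fun y => |y| ^ 3) (gint 1 3)).const_mul _
  have M := mul_meas_ge_le_integral_of_nonneg (μ := gam n) (f := fun g : Fin n → ℝ => ∑ i, √(l i) ^ 3 * |g i| ^ 3)
    (ae_of_all _ fun g => by positivity) (integrable_finsetSum _ fun i _ => hi i) r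
  rw [integral_finsetSum _ fun i _ => hi i] at M
  rw [le_div_iff₀ hr, mul_comm]
  refine M.trans ?_
  have hc3 : 0 ≤ c3 := integral_nonneg fun y => by positivity
  calc _ ≤ ∑ i : Fin n, √K ^ 3 * c3 := by
        refine Finset.sum_le_sum fun i _ => ?_
        rw [integral_const_mul, pi_int i (fun y => |y| ^ 3) (by fun_prop)]
        show √(l i) ^ 3 * c3 ≤ _
        have := Real.sqrt_le_sqrt (hK i)
        gcongr
    _ = _ := by simp; ring

lemma tailW {n : ℕ} (c : Fin n → ℝ) (hc0 : ∀ i, 0 ≤ c i) (hc1 : ∀ i, c i ≤ 1) (b : ℝ) {τ V : ℝ} (hτ : 0 < τ)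
    (hV : ∑ i, 2 * c i ^ 2 = V) (hVp : 0 < V) :
    (gam n).real {g | b + τ ≤ ∑ i, c i * ee (g i)} ≤ GM.gaussQ (b / √V)
      + Kst / τ ^ 3 * (n * (∫ g, |ee g| ^ 3 ∂(gaussianReal 0 1) + c3 * √2 ^ 3)) := by
  have hc3 : 0 ≤ c3 := integral_nonneg fun y => by positivity
  obtain ⟨v, hv⟩ : ∃ v : Fin n → ℝ≥0, ∀ i, (v i : ℝ) = 2 * c i ^ 2 :=
    ⟨fun i => (2 * c i ^ 2).toNNReal, fun i => Real.coe_toNNReal _ (by positivity)⟩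
  have T := tail_bound (P := gam n) (X := fun i g => c i * ee (g i))
    (fun i => (ee_meas.comp (measurable_pi_apply i)).const_mul _)
    (iIndepFun_pi (μ := fun _ => gaussianReal 0 1) (X := fun i g => c i * ee g)
      (fun i => (ee_meas.const_mul _).aemeasurable)) v
    (fun i => by rw [integral_const_mul, pi_int i ee ee_meas, ee_mean, mul_zero])
    (fun i => by
      simp_rw [mul_pow]
      rw [integral_const_mul, pi_int i (fun g => ee g ^ 2) (ee_meas.pow_const 2), ee_var, hv, mul_comm])
    (fun i => by
      simp_rw [abs_mul, mul_pow]
      exact (pi_integrable i _ (ee_int 3)).const_mul _) Finset.univ b hτ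
  have hsum : ((∑ i, v i : ℝ≥0) : ℝ) = V := by
    push_cast; rw [← hV]; exact Finset.sum_congr rfl fun i _ => hv i
  have hpos : 0 < ∑ i, v i := by
    have : (0:ℝ) < ((∑ i, v i : ℝ≥0) : ℝ) := by rw [hsum]; exact hVp
    exact_mod_cast this
  rw [gtail hpos, hsum] at T
  refine T.trans (add_le_add_right ?_ _)
  have := Kst_pos
  refine mul_le_mul_of_nonneg_left ?_ (by positivity)
  calc _ ≤ ∑ i : Fin n, (∫ g, |ee g| ^ 3 ∂(gaussianReal 0 1) + c3 * √2 ^ 3) := by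
        refine Finset.sum_le_sum fun i _ => add_le_add ?_ ?_
        · simp_rw [abs_mul, mul_pow]
          rw [integral_const_mul, pi_int i (fun g => |ee g| ^ 3) (ee_meas.abs.pow_const 3), abs_of_nonneg (hc0 i)]
          exact mul_le_of_le_one_left (integral_nonneg fun g => by positivity) (pow_le_one₀ (hc0 i) (hc1 i))
        · rw [hv]
          have : 2 * c i ^ 2 ≤ 2 := by nlinarith [pow_le_one₀ (n := 2) (hc0 i) (hc1 i)]
          gcongr
    _ = _ := by rw [Finset.sum_const, Finset.card_univ, Fintype.card_fin, nsmul_eq_mul]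

end GMX
end

section
namespace GMX


lemma ev_le (k : ℕ) {δ : ℝ} (hδ : 0 < δ) : ∀ᶠ n : ℕ in atTop, log n ^ k / √n ≤ δ :=
  ((lim_pow k).eventually (gt_mem_nhds hδ)).mono fun _ h => h.le

lemma ev_log (M : ℝ) : ∀ᶠ n : ℕ in atTop, M ≤ log n :=
  (tendsto_log_atTop.comp tendsto_natCast_atTop_atTop).eventually (eventually_ge_atTop M)

lemma ev_nat (M : ℝ) : ∀ᶠ n : ℕ in atTop, M ≤ n :=
  tendsto_natCast_atTop_atTop.eventually (eventually_ge_atTop M)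

lemma tailE {V0 : ℝ} (hV0 : 0 < V0) (q : ℝ) {C0 : ℝ} (hC0 : 0 ≤ C0) : ∃ c0 : ℝ, 0 < c0 ∧ ∀ᶠ n : ℕ in atTop, ∀ c : Fin n → ℝ,
    (∀ i, 0 ≤ c i) → (∀ i, c i ≤ 1) → |∑ i, 2 * c i ^ 2 - n * V0| ≤ C0 →
    (gam n).real {g | √(n * V0) * q + √n / √(log n) - C0 ≤ ∑ i, c i * ee (g i)} ≤ GM.gaussQ q - c0 / √(log n) := by
  obtain ⟨v0, hv0⟩ : ∃ v, v = √V0 := ⟨_, rfl⟩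
  have hv0p : 0 < v0 := by rw [hv0]; exact Real.sqrt_pos.2 hV0
  have hph := phim_pos q
  have hKst := Kst_pos
  obtain ⟨D, hD⟩ : ∃ D, D = (∫ g, |ee g| ^ 3 ∂(gaussianReal 0 1) + c3 * √2 ^ 3) := ⟨_, rfl⟩
  have hD0 : 0 ≤ D := by
    have hc3 : 0 ≤ c3 := integral_nonneg fun y => by positivity
    have : 0 ≤ ∫ g, |ee g| ^ 3 ∂(gaussianReal 0 1) := integral_nonneg fun y => by positivity
    rw [hD]; positivity
  refine ⟨phim q / (16 * v0), by positivity, ?_⟩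
  obtain ⟨A, hA⟩ : ∃ A, A = |q| * (C0 / v0) + C0 + 1 := ⟨_, rfl⟩
  have hA0 : 0 < A := by rw [hA]; positivity
  filter_upwards [ev_log 1, ev_log ((1 / (8 * v0)) ^ 2), ev_nat 1, ev_nat (2 * C0 / V0 + 1), ev_le 1 (δ := 1 / (2 * A)) (by positivity),
    ev_le 2 (δ := phim q / (16 * v0) / (64 * Kst * D + 1)) (by positivity)] with n h1 h2 h3 h4 h5 h6 c hc0 hc1 hV
  obtain ⟨L, hL⟩ : ∃ L, L = √(log n) := ⟨_, rfl⟩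
  obtain ⟨s, hs⟩ : ∃ s, s = √(n:ℝ) := ⟨_, rfl⟩
  have hL1 : 1 ≤ L := by rw [hL]; exact Real.one_le_sqrt.2 h1
  have hLsq : L ^ 2 = log n := by rw [hL]; exact Real.sq_sqrt (by linarith)
  have hs1 : 1 ≤ s := by rw [hs]; exact Real.one_le_sqrt.2 h3
  have hssq : s ^ 2 = n := by rw [hs]; exact Real.sq_sqrt (by linarith)
  have hw : √(n * V0) = s * v0 := by rw [Real.sqrt_mul (by linarith), hs, hv0]
  have hv0sq : v0 ^ 2 = V0 := by rw [hv0]; exact Real.sq_sqrt hV0.le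
  rw [← hL, ← hs, hw]
  rw [← hs, ← hLsq] at h5 h6
  obtain ⟨V, hVd⟩ : ∃ V, ∑ i, 2 * c i ^ 2 = V := ⟨_, rfl⟩
  rw [hVd, abs_le] at hV
  have hnV : 2 * C0 + V0 ≤ n * V0 := by
    have := mul_le_mul_of_nonneg_right h4 hV0.le
    rw [add_mul, div_mul_cancel₀ _ hV0.ne'] at this; linarith
  have hVp : 0 < V := by linarith
  obtain ⟨u, hu⟩ : ∃ u, u = √V := ⟨_, rfl⟩
  have hup : 0 < u := by rw [hu]; exact Real.sqrt_pos.2 hVp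
  have husq : u ^ 2 = V := by rw [hu]; exact Real.sq_sqrt hVp.le
  have hwp : 0 < s * v0 := by positivity
  have hdiff : |u - s * v0| ≤ C0 / v0 := by
    rw [le_div_iff₀ hv0p]
    have e : |u - s * v0| * (u + s * v0) = |V - n * V0| := by
      rw [← husq, ← hssq, ← hv0sq, show u ^ 2 - s ^ 2 * v0 ^ 2 = (u - s * v0) * (u + s * v0) by ring, abs_mul, abs_of_pos (add_pos hup hwp)]
    have e2 : |V - n * V0| ≤ C0 := abs_le.2 hV
    refine le_trans ?_ (e.le.trans e2)
    refine mul_le_mul_of_nonneg_left ?_ (abs_nonneg _)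
    nlinarith
  have hu2 : u ≤ 2 * (s * v0) := by
    refine le_of_sq_le_sq ?_ (by positivity)
    rw [husq, show (2 * (s * v0)) ^ 2 = 4 * (s ^ 2 * v0 ^ 2) by ring, hssq, hv0sq]
    linarith
  have hL0 : 0 < L := by linarith
  have hs0 : 0 < s := by linarith
  have hsL : A ≤ s / (2 * L) := by
    rw [pow_one, div_le_div_iff₀ hs0 (by positivity)] at h5
    rw [le_div_iff₀ (by positivity)]
    have : L * (2 * A) ≤ L ^ 2 * (2 * A) := by
      refine mul_le_mul_of_nonneg_right ?_ (by positivity); nlinarith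
    linarith
  have T := tailW c hc0 hc1 (s * v0 * q + s / L - C0 - s / (4 * L)) (τ := s / (4 * L)) (by positivity) hVd hVp
  rw [sub_add_cancel, ← hu, ← hD] at T
  refine T.trans ?_
  have hη1 : 1 / (8 * v0 * L) ≤ 1 := by
    have q1 : 1 / (8 * v0) ≤ L := by rw [hL]; exact Real.le_sqrt_of_sq_le h2
    rw [← div_div, div_le_one hL0]; exact q1
  have hQ := qgain q (η := 1 / (8 * v0 * L)) (by positivity) hη1
  have hb : q + 1 / (8 * v0 * L) ≤ (s * v0 * q + s / L - C0 - s / (4 * L)) / u := by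
    rw [le_div_iff₀ hup, add_mul]
    have q1 : q * u ≤ s * v0 * q + |q| * (C0 / v0) := by
      have : q * (u - s * v0) ≤ |q| * |u - s * v0| := by rw [← abs_mul]; exact le_abs_self _
      have := mul_le_mul_of_nonneg_left hdiff (abs_nonneg q)
      linarith
    have q2 : 1 / (8 * v0 * L) * u ≤ s / (4 * L) := by
      calc _ ≤ 1 / (8 * v0 * L) * (2 * (s * v0)) := by gcongr
        _ = _ := by field_simp; norm_num
    have q3 : s / L = s / (4 * L) + s / (4 * L) + s / (2 * L) := by field_simp; norm_num
    linarith
  have hanti := gaussQ_anti hb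
  have hlast : Kst / (s / (4 * L)) ^ 3 * (n * D) ≤ phim q / (16 * v0) / L := by
    have e : Kst / (s / (4 * L)) ^ 3 * (n * D) = (64 * Kst * D) * ((L ^ 2) ^ 2 / s) / L := by
      rw [← hssq]; field_simp; ring
    rw [e]
    refine div_le_div_of_nonneg_right ?_ hL0.le
    calc _ ≤ (64 * Kst * D + 1) * (phim q / (16 * v0) / (64 * Kst * D + 1)) := by
          refine mul_le_mul (by linarith) h6 (by positivity) (by positivity)
      _ = _ := by field_simp
  have e : 1 / (8 * v0 * L) * phim q = phim q / (16 * v0) / L + phim q / (16 * v0) / L := by field_simp; norm_num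
  linarith

lemma tm_eq {θ l : ℝ} (hθ : 0 < θ) (hl : 0 < l) (g : ℝ) :
    tm (1 / (2 * θ)) (max (l - θ) 0) (√l * g) = min θ l + (l * θ ^ 2 / (max l θ) ^ 2) * ee g := by
  unfold tm ee
  rw [mul_pow, Real.sq_sqrt hl.le]
  rcases le_total l θ with h | h
  · rw [max_eq_right (by linarith), max_eq_right h, min_eq_right h]
    field_simp; ring
  · rw [max_eq_left (by linarith), max_eq_left h, min_eq_left h]
    have e : 1 + 2 * (1 / (2 * θ)) * (l - θ) = l / θ := by field_simp; ring
    rw [e]; field_simp; ring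

lemma tl_eq {θ l : ℝ} (hθ : 0 < θ) (hl : 0 < l) (g : ℝ) :
    tl (1 / (2 * θ)) (max (l - θ) 0) (√l * g) = max 0 ((1 / 2) * log (l / θ)) + 1 / (2 * θ) * min θ l + (min 1 (l / θ) / 2) * ee g := by
  unfold tl ee
  rw [mul_pow, Real.sq_sqrt hl.le]
  rcases le_total l θ with h | h
  · have h1 : l / θ ≤ 1 := (div_le_one hθ).2 h
    have h2 : log (l / θ) ≤ 0 := log_nonpos (by positivity) h1
    rw [max_eq_right (by linarith), min_eq_right h, min_eq_right h1, max_eq_left (by linarith)]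
    simp; field_simp; ring
  · have h1 : 1 ≤ l / θ := (one_le_div hθ).2 h
    have h2 : 0 ≤ log (l / θ) := log_nonneg h1
    rw [max_eq_left (by linarith), min_eq_left h, min_eq_left h1, max_eq_right (by linarith)]
    have e : 1 + 2 * (1 / (2 * θ)) * (l - θ) = l / θ := by field_simp; ring
    rw [e]; field_simp; ring

end GMX
end

section
namespace GMX


def nu (a σ θ : ℝ) (n : ℕ) (i : Fin n) : ℝ := max (GM.S a σ (wf n i) - θ) 0
def Bn (a d : ℝ) (n : ℕ) : ℝ := (√(n * d) - 1 / n * (1 / (1 - a) ^ 2)) ^ 2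
def xx (a σ : ℝ) (n : ℕ) (g : Fin n → ℝ) (i : Fin n) : ℝ := √(GM.S a σ (wf n i)) * g i

def typ (a σ d θ q : ℝ) (n : ℕ) : Set (Fin n → ℝ) :=
  {g | |∑ i, tm (1 / (2 * θ)) (nu a σ θ n i) (xx a σ n g i) - Bn a d n| ≤ √n * log n} ∩
  ({g | ∑ i, |xx a σ n g i| ^ 3 ≤ n * log n} ∩
  {g | ∑ i, tl (1 / (2 * θ)) (nu a σ θ n i) (xx a σ n g i) - 1 / (2 * θ) * Bn a d n
      ≤ n * GM.RU a σ θ + √(n * GM.VU a σ θ) * q + √n / √(log n)})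

lemma typ_meas (a σ d θ q : ℝ) (n : ℕ) : MeasurableSet (typ a σ d θ q n) := by
  have h : ∀ i, Measurable fun g : Fin n → ℝ => xx a σ n g i := fun i => by unfold xx; fun_prop
  have h1 : ∀ i, Measurable fun g : Fin n → ℝ => tm (1 / (2 * θ)) (nu a σ θ n i) (xx a σ n g i) := fun i => by
    unfold tm; have := h i; fun_prop
  have h2 : ∀ i, Measurable fun g : Fin n → ℝ => tl (1 / (2 * θ)) (nu a σ θ n i) (xx a σ n g i) := fun i => by
    unfold tl; have := h i; fun_prop
  unfold typ
  refine MeasurableSet.inter (measurableSet_le ?_ measurable_const) (MeasurableSet.inter (measurableSet_le ?_ measurable_const) (measurableSet_le ?_ measurable_const))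
  · exact ((Finset.measurable_sum _ fun i _ => h1 i).sub measurable_const).abs
  · exact Finset.measurable_sum _ fun i _ => (h i).abs.pow_const 3
  · exact (Finset.measurable_sum _ fun i _ => h2 i).sub measurable_const

lemma Bn_close {a d : ℝ} (hd : 0 < d) (n : ℕ) (hn : (1:ℝ) ≤ n) :
    |n * d - Bn a d n| ≤ 2 * √d * (1 / (1 - a) ^ 2) + (1 / (1 - a) ^ 2) ^ 2 := by
  unfold Bn
  obtain ⟨k, hk⟩ : ∃ k, k = 1 / (1 - a) ^ 2 := ⟨_, rfl⟩
  have hk0 : 0 ≤ k := by rw [hk]; positivity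
  rw [← hk]
  have e : n * d - (√(n * d) - 1 / n * k) ^ 2 = 2 * (√(n * d) / n) * k - (1 / n * k) ^ 2 := by
    rw [sub_sq, Real.sq_sqrt (by positivity)]; ring
  rw [e]
  have h1 : √(n * d) / n ≤ √d := by
    rw [div_le_iff₀ (by linarith), Real.sqrt_mul (by linarith), mul_comm]
    refine mul_le_mul_of_nonneg_left ?_ (Real.sqrt_nonneg _)
    rw [Real.sqrt_le_left (by linarith)]; nlinarith
  have h2 : 1 / n * k ≤ k := mul_le_of_le_one_left hk0 (by rw [div_le_one (by linarith)]; exact hn)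
  have h3 : (1 / n * k) ^ 2 ≤ k ^ 2 := pow_le_pow_left₀ (by positivity) h2 2
  have h4 : 0 ≤ √(n * d) / n := by positivity
  have h5 : 2 * (√(n * d) / n) * k ≤ 2 * √d * k := by gcongr
  have h6 : 0 ≤ (1 / n * k) ^ 2 := by positivity
  have h7 : 0 ≤ 2 * (√(n * d) / n) * k := by positivity
  rw [abs_le]; constructor <;> linarith

lemma typ_prob {a σ d θ : ℝ} (ha0 : 0 ≤ a) (ha1 : a < 1) (hσ : 0 < σ) (hd : 0 < d) (hdmax : d < σ ^ 2 / (1 - a ^ 2))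
    (hθ : 0 < θ) (hwater : GM.waterEq a σ θ d) (q : ℝ) :
    ∃ c0 : ℝ, 0 < c0 ∧ ∀ᶠ n : ℕ in atTop, (gam n).real (typ a σ d θ q n)ᶜ ≤ GM.gaussQ q - c0 / √(log n) := by
  obtain ⟨C, c, hc, hVp, hsp⟩ := spec ha0 ha1 hσ hdmax hθ hwater
  have hC : 0 ≤ C := (abs_nonneg _).trans (hsp 0).1
  obtain ⟨K, hK⟩ : ∃ K, K = σ ^ 2 / (1 - a) ^ 2 := ⟨_, rfl⟩
  have hK0 : 0 ≤ K := by rw [hK]; positivity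
  obtain ⟨k1, hk1⟩ : ∃ k, k = 2 * √d * (1 / (1 - a) ^ 2) + (1 / (1 - a) ^ 2) ^ 2 := ⟨_, rfl⟩
  have hk10 : 0 ≤ k1 := by rw [hk1]; positivity
  obtain ⟨C0, hC0⟩ : ∃ C0, C0 = C + 1 / (2 * θ) * (C + k1) := ⟨_, rfl⟩
  have hC00 : 0 ≤ C0 := by rw [hC0]; positivity
  have hCC0 : C ≤ C0 := by rw [hC0]; have : 0 ≤ 1 / (2 * θ) * (C + k1) := by positivity
                           linarith
  obtain ⟨c0, hc0, hT⟩ := tailE hVp q hC00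
  have hc3 : 0 ≤ c3 := integral_nonneg fun y => by positivity
  obtain ⟨D, hD⟩ : ∃ D, D = 8 * K ^ 2 + √K ^ 3 * c3 + 1 := ⟨_, rfl⟩
  have hD0 : 0 < D := by rw [hD]; positivity
  refine ⟨c0 / 2, by positivity, ?_⟩
  filter_upwards [hT, ev_log 1, ev_log ((2 * D / c0) ^ 2), ev_log (2 * (C + k1)), ev_nat 1] with n hT h1 h2 h4 h3
  obtain ⟨s1, s2, s3, -⟩ := hsp n
  have hlp : ∀ i : Fin n, 0 < GM.S a σ (wf n i) := fun i => S_pos ha0 ha1 hσ _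
  have hlK : ∀ i : Fin n, GM.S a σ (wf n i) ≤ K := fun i => hK ▸ S_le ha0 ha1 _
  generalize hl : (fun i : Fin n => GM.S a σ (wf n i)) = l at *
  have hl' : ∀ i, GM.S a σ (wf n i) = l i := fun i => by rw [← hl]
  simp_rw [hl'] at s1 s2 s3 hlp hlK
  have hB : |n * d - Bn a d n| ≤ k1 := hk1 ▸ Bn_close hd n h3
  have hs1 : 1 ≤ √(n:ℝ) := Real.one_le_sqrt.2 h3
  have hsq : √(n:ℝ) ^ 2 = n := Real.sq_sqrt (by linarith)
  have hκ : ∀ i, |l i * θ ^ 2 / (max (l i) θ) ^ 2| ≤ K := by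
    intro i
    have hm : 0 < max (l i) θ := lt_max_of_lt_right hθ
    have hli := hlp i
    rw [abs_of_nonneg (by positivity), div_le_iff₀ (by positivity)]
    exact mul_le_mul (hlK i) (pow_le_pow_left₀ hθ.le (le_max_right _ _) 2) (by positivity) hK0
  have P1 := cheb _ hκ (r := √n * log n / 2) (by positivity)
  have P2 := mark3 l hlK (r := n * log n) (by positivity)
  have hc1 : ∀ i, 0 ≤ min 1 (l i / θ) / 2 := fun i => by
    have : 0 < l i / θ := div_pos (hlp i) hθ
    have := le_min zero_le_one this.le
    linarith
  have hc2 : ∀ i, min 1 (l i / θ) / 2 ≤ 1 := fun i => by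
    have := min_le_left 1 (l i / θ); linarith
  have P3 := hT (fun i => min 1 (l i / θ) / 2) hc1 hc2 (by
    have e : ∑ i, 2 * (min 1 (l i / θ) / 2) ^ 2 = ∑ i, (min 1 (l i / θ)) ^ 2 / 2 :=
      Finset.sum_congr rfl fun i _ => by ring
    rw [e]; exact s3.trans hCC0)
  have hsub : (typ a σ d θ q n)ᶜ ⊆ {g | √n * log n / 2 ≤ |∑ i, (l i * θ ^ 2 / (max (l i) θ) ^ 2) * ee (g i)|} ∪
      ({g | n * log n ≤ ∑ i, |√(l i) * g i| ^ 3} ∪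
      {g | √(n * GM.VU a σ θ) * q + √n / √(log n) - C0 ≤ ∑ i, min 1 (l i / θ) / 2 * ee (g i)}) := by
    intro g hg
    by_contra hcon
    apply hg
    simp only [Set.mem_union, Set.mem_ofPred_eq, not_or, not_le] at hcon
    obtain ⟨q1, q2, q3⟩ := hcon
    have e1 : ∑ i, tm (1 / (2 * θ)) (nu a σ θ n i) (xx a σ n g i) = ∑ i, min θ (l i) + ∑ i, (l i * θ ^ 2 / (max (l i) θ) ^ 2) * ee (g i) := by
      rw [← Finset.sum_add_distrib]
      refine Finset.sum_congr rfl fun i _ => ?_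
      unfold nu xx; rw [hl', tm_eq hθ (hlp i)]
    have e2 : ∑ i, tl (1 / (2 * θ)) (nu a σ θ n i) (xx a σ n g i) = ∑ i, max 0 ((1 / 2) * log (l i / θ))
        + 1 / (2 * θ) * ∑ i, min θ (l i) + ∑ i, (min 1 (l i / θ) / 2) * ee (g i) := by
      rw [Finset.mul_sum, ← Finset.sum_add_distrib, ← Finset.sum_add_distrib]
      refine Finset.sum_congr rfl fun i _ => ?_
      unfold nu xx; rw [hl', tl_eq hθ (hlp i)]
    rw [abs_le] at hB s1 s2
    have hmB : |∑ i, min θ (l i) - Bn a d n| ≤ C + k1 := by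
      rw [abs_le]; constructor <;> linarith [hB.1, hB.2, s1.1, s1.2]
    refine ⟨?_, ?_, ?_⟩
    · rw [Set.mem_ofPred_eq]
      rw [e1]
      have : C + k1 ≤ √n * log n / 2 := by
        have : log n ≤ √n * log n := le_mul_of_one_le_left (by linarith) hs1
        linarith
      rw [abs_lt] at q1
      rw [abs_le] at hmB ⊢
      constructor <;> linarith [q1.1, q1.2, hmB.1, hmB.2]
    · show ∑ i, |xx a σ n g i| ^ 3 ≤ _
      unfold xx; simp_rw [hl']; exact q2.le
    · rw [Set.mem_ofPred_eq]
      rw [e2]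
      have := mul_le_mul_of_nonneg_left (abs_le.1 hmB).2 (by positivity : 0 ≤ 1 / (2 * θ))
      rw [mul_sub] at this
      linarith [s2.1, s2.2]
  refine (measureReal_mono hsub).trans ((measureReal_union_le _ _).trans ?_)
  refine (add_le_add P1 ((measureReal_union_le _ _).trans (add_le_add P2 P3))).trans ?_
  have hlog : 0 < log (n:ℝ) := by linarith
  have hL0 : 0 < √(log n) := Real.sqrt_pos.2 hlog
  have hLsq : √(log n) ^ 2 = log n := Real.sq_sqrt hlog.le
  have f1 : 2 * K ^ 2 * n / (√n * log n / 2) ^ 2 ≤ 8 * K ^ 2 / log n := by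
    rw [div_pow, mul_pow, hsq]
    have : 2 * K ^ 2 * n / (n * log n ^ 2 / 2 ^ 2) = 8 * K ^ 2 / log n / log n := by field_simp; ring
    rw [this]
    exact div_le_self (by positivity) h1
  have f2 : √K ^ 3 * c3 * n / (n * log n) = √K ^ 3 * c3 / log n := by field_simp
  have f3 : D / log n ≤ c0 / 2 / √(log n) := by
    have q1 : 2 * D / c0 ≤ √(log n) := Real.le_sqrt_of_sq_le h2
    rw [div_le_iff₀ hc0] at q1
    rw [div_le_div_iff₀ hlog hL0]
    have : D * √(log n) ≤ (√(log n) * c0 / 2) * √(log n) := mul_le_mul_of_nonneg_right (by linarith) hL0.le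
    calc _ ≤ _ := this
      _ = c0 / 2 * √(log n) ^ 2 := by ring
      _ = _ := by rw [hLsq]
  have f4 : 8 * K ^ 2 / log n + √K ^ 3 * c3 / log n ≤ D / log n := by
    rw [← add_div]; refine div_le_div_of_nonneg_right ?_ hlog.le
    rw [hD]; linarith
  have f5 : c0 / √(log n) = c0 / 2 / √(log n) + c0 / 2 / √(log n) := by ring
  rw [f2]
  linarith

end GMX
end

section
namespace GMX


lemma grid (n : ℕ) (hn : 0 < n) (s : ℝ) (hs : |s| < (n:ℝ) ^ 2) :
    ∃ l : Fin (2 * n ^ 3 + 1), |s - (-(n:ℝ) ^ 2 + (l : ℕ) / n)| ≤ 1 / n := by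
  have hn' : (0:ℝ) < n := by exact_mod_cast hn
  rw [abs_lt] at hs
  have h0 : 0 ≤ (s + n ^ 2) * n := mul_nonneg (by linarith) hn'.le
  have h1 : (s + n ^ 2) * n < 2 * n ^ 3 := by
    have := mul_lt_mul_of_pos_right (show s + (n:ℝ) ^ 2 < 2 * n ^ 2 by linarith) hn'
    calc _ < _ := this
      _ = _ := by ring
  refine ⟨⟨⌊(s + n ^ 2) * n⌋₊, ?_⟩, ?_⟩
  · have : (⌊(s + n ^ 2) * n⌋₊ : ℝ) ≤ (s + n ^ 2) * n := Nat.floor_le h0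
    have : (⌊(s + n ^ 2) * n⌋₊ : ℝ) < ((2 * n ^ 3 : ℕ) : ℝ) := by push_cast; linarith
    have := Nat.cast_lt.1 this
    omega
  · have q1 : (⌊(s + n ^ 2) * n⌋₊ : ℝ) ≤ (s + n ^ 2) * n := Nat.floor_le h0
    have q2 := Nat.lt_floor_add_one ((s + n ^ 2) * n)
    have e : s - (-(n:ℝ) ^ 2 + (⌊(s + n ^ 2) * n⌋₊ : ℝ) / n) = ((s + n ^ 2) * n - ⌊(s + n ^ 2) * n⌋₊) / n := by
      field_simp; ring
    show |s - (-(n:ℝ) ^ 2 + (⌊(s + n ^ 2) * n⌋₊ : ℝ) / n)| ≤ 1 / n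
    rw [e, abs_of_nonneg (div_nonneg (by linarith) hn'.le)]
    exact div_le_div_of_nonneg_right (by linarith) hn'.le

lemma build {a σ d θ q ε : ℝ} (ha0 : 0 ≤ a) (ha1 : a < 1) (hσ : 0 < σ) (hd : 0 < d)
    (n : ℕ) (hn : 0 < n) (N : ℕ) (hN : 0 < N) (p : ℝ) (hp1 : p ≤ 1)
    (hk : 1 / (n:ℝ) * (1 / (1 - a) ^ 2) ≤ √(n * d))
    (hball : ∀ g ∈ typ a σ d θ q n, p ≤
      (gam n).real {h | ∑ i, (xx a σ n g i - √(nu a σ θ n i) * h i) ^ 2 ≤ Bn a d n})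
    (hprob : (gam n).real (typ a σ d θ q n)ᶜ + (1 - p) ^ N
      + 2 * σ * (∫ y, |y| ^ 1 ∂(gaussianReal 0 1)) / n ≤ ε) :
    GM.rate a σ n d ε ≤ log ((N * (2 * n ^ 3 + 1) : ℕ) : ℝ) / n := by
  obtain ⟨Gm, c, hGm, hmap, htr⟩ := transfer ha0 ha1 hσ n hn
  have hn' : (0:ℝ) < n := by exact_mod_cast hn
  have hxm : ∀ i, Measurable fun g : Fin n → ℝ => xx a σ n g i := fun i => by unfold xx; fun_prop
  obtain ⟨ys, hys⟩ := codebook (gam n) (gam n)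
    (fun r : (Fin n → ℝ) × (Fin n → ℝ) => ∑ i, (xx a σ n r.1 i - √(nu a σ θ n i) * r.2 i) ^ 2 ≤ Bn a d n)
    (measurableSet_le (Finset.measurable_sum _ fun i _ => by
      have : Measurable fun r : (Fin n → ℝ) × (Fin n → ℝ) => xx a σ n r.1 i := (hxm i).comp measurable_fst
      have h2 : Measurable fun r : (Fin n → ℝ) × (Fin n → ℝ) => r.2 i := by fun_prop
      exact ((this.sub (h2.const_mul _)).pow_const 2)) measurable_const)
    (typ a σ d θ q n) (typ_meas a σ d θ q n) p hp1 hball N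
  have hev : ∀ m, Measurable (GM.evolve a m) := fun m => by unfold GM.evolve; fun_prop
  let cs : Fin (N * (2 * n ^ 3 + 1)) → (Fin n → ℝ) := fun j =>
    c (fun i => √(nu a σ θ n i) * ys (finProdFinEquiv.symm j).1 i)
      (-(n:ℝ) ^ 2 + ((finProdFinEquiv.symm j).2 : ℕ) / n)
  refine mkcode a σ d ε n _ (by positivity) cs ?_
  have hdm : ∀ j, Measurable fun u => GM.distortion n u (cs j) := by
    intro j; unfold GM.distortion; fun_prop
  have hms : MeasurableSet {u | ∀ j, d < GM.distortion n u (cs j)} := by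
    have : {u | ∀ j, d < GM.distortion n u (cs j)} = ⋂ j, {u | d < GM.distortion n u (cs j)} := by ext; simp
    rw [this]
    exact MeasurableSet.iInter fun j => measurableSet_lt measurable_const (hdm j)
  have hr : Measurable fun (z : Fin (n+1) → ℝ) (j : Fin n) => z j.castSucc := by fun_prop
  unfold GM.sourceLaw
  rw [← gaussPi_restrict σ hσ n, Measure.map_map (hev n) hr, Measure.map_apply ((hev n).comp hr) hms]
  rw [← ofReal_measureReal]
  refine ENNReal.ofReal_le_ofReal (le_trans ?_ hprob)
  have hsub : (GM.evolve a n ∘ fun (z : Fin (n+1) → ℝ) (j : Fin n) => z j.castSucc) ⁻¹' {u | ∀ j, d < GM.distortion n u (cs j)}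
      ⊆ (Gm ⁻¹' (typ a σ d θ q n)ᶜ ∪ Gm ⁻¹' (typ a σ d θ q n ∩ {x | ∀ j, ¬ ∑ i, (xx a σ n x i - √(nu a σ θ n i) * ys j i) ^ 2 ≤ Bn a d n}))
        ∪ {z | (n : ℝ) ^ 2 ≤ |GM.evolve a (n + 1) z (Fin.last n)|} := by
    intro z hz
    by_contra hcon
    simp only [Set.mem_union, not_or, Set.mem_preimage, Set.mem_compl_iff, not_not, Set.mem_inter_iff,
      Set.mem_ofPred_eq, not_le, not_and, not_forall] at hcon
    obtain ⟨⟨h1, h2⟩, h3⟩ := hcon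
    obtain ⟨k, hk'⟩ := h2 h1
    push Not at hk'
    obtain ⟨l, hl⟩ := grid n hn _ h3
    simp only [Set.mem_preimage, Set.mem_ofPred_eq, Function.comp] at hz
    have hzj := hz (finProdFinEquiv (k, l))
    simp only [cs, Equiv.symm_apply_apply] at hzj
    have ht := htr z (fun i => √(nu a σ θ n i) * ys k i) (-(n:ℝ) ^ 2 + (l : ℕ) / n)
    have hS : √(∑ i, (√(GM.S a σ (wf n i)) * Gm z i - √(nu a σ θ n i) * ys k i) ^ 2) ≤ √(n * d) - 1 / (n:ℝ) * (1 / (1 - a) ^ 2) := by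
      rw [Real.sqrt_le_left (by linarith)]
      exact hk'
    have h5 : |GM.evolve a (n + 1) z (Fin.last n) - (-(n:ℝ) ^ 2 + (l : ℕ) / n)| * (1 / (1 - a) ^ 2) ≤ 1 / n * (1 / (1 - a) ^ 2) :=
      mul_le_mul_of_nonneg_right hl (by positivity)
    have h6 := ht.trans (add_le_add hS h5)
    rw [sub_add_cancel] at h6
    have h7 := (Real.sqrt_le_sqrt_iff (by positivity)).1 h6
    unfold GM.distortion at hzj
    rw [one_div, inv_mul_eq_div, lt_div_iff₀ hn'] at hzj
    linarith
  refine (measureReal_mono hsub).trans ((measureReal_union_le _ _).trans (add_le_add ((measureReal_union_le _ _).trans (add_le_add ?_ ?_)) (stail ha0 ha1 hσ n hn)))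
  · rw [← map_measureReal_apply hGm (typ_meas _ _ _ _ _ _).compl, hmap]
  · rw [← map_measureReal_apply hGm, hmap]
    · exact hys
    · refine (typ_meas _ _ _ _ _ _).inter ?_
      have : {x | ∀ j, ¬ ∑ i, (xx a σ n x i - √(nu a σ θ n i) * ys j i) ^ 2 ≤ Bn a d n} = ⋂ j, {x | ∑ i, (xx a σ n x i - √(nu a σ θ n i) * ys j i) ^ 2 ≤ Bn a d n}ᶜ := by ext x; simp
      rw [this]
      exact MeasurableSet.iInter fun j => (measurableSet_le (Finset.measurable_sum _ fun i _ => ((hxm i).sub_const _).pow_const 2) measurable_const).compl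

end GMX
end

section
namespace GMX


lemma logM {F l : ℝ} (hF : 0 ≤ F) (hl : 1 ≤ l) (n : ℕ) (hn : 0 < n) (hln : l = log n) :
    log ((⌈exp F * l⌉₊ * (2 * n ^ 3 + 1) : ℕ) : ℝ) ≤ F + 6 * l := by
  have hn1 : (1:ℝ) ≤ n := by exact_mod_cast hn
  have he : 1 ≤ exp F := Real.one_le_exp hF
  have h1 : 1 ≤ exp F * l := one_le_mul_of_one_le_of_one_le he hl
  have h2 : (⌈exp F * l⌉₊ : ℝ) ≤ 2 * (exp F * l) := by
    have := Nat.ceil_lt_add_one (zero_le_one.trans h1)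
    linarith
  have h3 : 2 * (n:ℝ) ^ 3 + 1 ≤ 3 * n ^ 3 := by
    have := one_le_pow₀ hn1 (n := 3); linarith
  have hpos : 0 < ⌈exp F * l⌉₊ := Nat.ceil_pos.2 (by linarith)
  have hpos' : (0:ℝ) < ⌈exp F * l⌉₊ := by exact_mod_cast hpos
  push_cast
  have h4 : (⌈exp F * l⌉₊ : ℝ) * (2 * (n:ℝ) ^ 3 + 1) ≤ 2 * (exp F * l) * (3 * n ^ 3) :=
    mul_le_mul h2 h3 (by positivity) (by positivity)
  refine (Real.log_le_log (by positivity) h4).trans ?_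
  have e : 2 * (exp F * l) * (3 * (n:ℝ) ^ 3) = 6 * (exp F * (l * n ^ 3)) := by ring
  have hn0 : (n:ℝ) ≠ 0 := by positivity
  rw [e, Real.log_mul (by norm_num) (by positivity), Real.log_mul (by positivity) (by positivity),
    Real.log_mul (by positivity) (by positivity), Real.log_exp, Real.log_pow, ← hln]
  have h6 : log 6 ≤ 2 := by
    rw [Real.log_le_iff_le_exp (by norm_num)]
    have : exp 2 = exp 1 * exp 1 := by rw [← Real.exp_add]; norm_num
    rw [this]
    have := Real.exp_one_gt_d9
    nlinarith
  have h7 := Real.log_le_sub_one_of_pos (show 0 < l by linarith)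
  push_cast
  linarith

lemma pow_bd {F l : ℝ} (hF : 0 ≤ F) : (1 - exp (-F)) ^ ⌈exp F * l⌉₊ ≤ exp (-l) := by
  have h1 : 1 - exp (-F) ≤ exp (-exp (-F)) := Real.one_sub_le_exp_neg _
  have h0 : 0 ≤ 1 - exp (-F) := by
    have : exp (-F) ≤ 1 := Real.exp_le_one_iff.2 (by linarith)
    linarith
  refine (pow_le_pow_left₀ h0 h1 _).trans ?_
  rw [← Real.exp_nat_mul]
  refine Real.exp_le_exp.2 ?_
  have := mul_le_mul_of_nonneg_right (Nat.le_ceil (exp F * l)) (Real.exp_pos (-F)).le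
  have e : exp F * l * exp (-F) = l := by rw [mul_right_comm, ← Real.exp_add]; simp
  rw [e] at this
  linarith

lemma final {a σ ε d θ q : ℝ}
    (ha0 : 0 ≤ a) (ha1 : a < 1) (hσ : 0 < σ) (hε1 : ε < 1)
    (hd0 : 0 < d) (hdmax : d < σ ^ 2 / (1 - a ^ 2))
    (hθ : 0 < θ) (hwater : GM.waterEq a σ θ d)
    (hq : GM.gaussQ q = ε) :
    ∃ C : ℝ, 0 < C ∧ ∀ᶠ n : ℕ in atTop, GM.rate a σ n d ε ≤
      GM.RU a σ θ + √(GM.VU a σ θ / n) * q + C / (√(log n) * √n) := by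
  obtain ⟨Cs, c, hc, hVp, hsp⟩ := spec ha0 ha1 hσ hdmax hθ hwater
  obtain ⟨c0, hc0, hty⟩ := typ_prob ha0 ha1 hσ hd0 hdmax hθ hwater q
  obtain ⟨C, hC, hcore⟩ := core (1 / (2 * θ)) (σ ^ 2 / (1 - a) ^ 2) c (by positivity) (by positivity) hc
  obtain ⟨K, hK⟩ : ∃ K, K = 2 * σ * (∫ y, |y| ^ 1 ∂(gaussianReal 0 1)) := ⟨_, rfl⟩
  have hK0 : 0 ≤ K := by
    rw [hK]; exact mul_nonneg (by positivity) (integral_nonneg fun y => by positivity)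
  obtain ⟨k, hkk⟩ : ∃ k, k = 1 / (1 - a) ^ 2 := ⟨_, rfl⟩
  have hk0 : 0 ≤ k := by rw [hkk]; positivity
  refine ⟨7 + C, by positivity, ?_⟩
  filter_upwards [hty, hcore, ev_log 1, ev_nat 1, ev_nat (k ^ 2 / d), ev_nat (Cs / c),
    ev_le 1 (δ := c0 / (1 + K)) (by positivity), ev_le 2 zero_lt_one] with n hty hcore hl1 hn1 hnk hnc hd1 hd2
  have hn : 0 < n := by exact_mod_cast (zero_lt_one.trans_le hn1)
  have hn' : (0:ℝ) < n := by linarith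
  have hsn : 1 ≤ √(n:ℝ) := Real.one_le_sqrt.2 hn1
  have hsq : √(n:ℝ) * √n = n := Real.mul_self_sqrt hn'.le
  obtain ⟨l, hl⟩ : ∃ l, l = log (n:ℝ) := ⟨_, rfl⟩
  have hexpl : exp (-l) = 1 / n := by rw [hl, Real.exp_neg, Real.exp_log hn', one_div]
  have hl0 : 1 ≤ l := hl ▸ hl1
  have hsl : 1 ≤ √l := Real.one_le_sqrt.2 hl0
  have hsll : √l * √l = l := Real.mul_self_sqrt (by linarith)
  have hslle : √l ≤ l := by
    have := mul_le_mul_of_nonneg_left hsl (zero_le_one.trans hsl)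
    linarith
  obtain ⟨F, hF⟩ : ∃ F, F = n * GM.RU a σ θ + √(n * GM.VU a σ θ) * q + √n / √l + C * (√n / l) := ⟨_, rfl⟩
  have hball : ∀ g ∈ typ a σ d θ q n, exp (-F) ≤
      (gam n).real {h | ∑ i, (xx a σ n g i - √(nu a σ θ n i) * h i) ^ 2 ≤ Bn a d n} := by
    rintro g ⟨g1, g2, g3⟩
    rw [Set.mem_ofPred_eq] at g1 g2 g3
    refine le_trans ?_ (hcore (Bn a d n) (nu a σ θ n) (xx a σ n g) (fun i => le_max_right _ _) (fun i => ?_) ?_ g1 g2)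
    · refine Real.exp_le_exp.2 ?_
      rw [← hl] at g3 ⊢
      linarith
    · exact max_le (by linarith [S_le (σ := σ) ha0 ha1 (wf n i)]) (by positivity)
    · have := (hsp n).2.2.2
      rw [div_le_iff₀ hc] at hnc
      have e : c * n = 2 * c * n - n * c := by ring
      rw [e]
      exact le_trans (by linarith) this
  have hs0 : 0 < c0 / √l := by positivity
  rw [hq, ← hl] at hty
  have hne : (typ a σ d θ q n).Nonempty := by
    by_contra h
    rw [Set.not_nonempty_iff_eq_empty] at h
    rw [h, Set.compl_empty, probReal_univ] at hty
    linarith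
  obtain ⟨g0, hg0⟩ := hne
  have hF0 : 0 ≤ F := by
    have := (hball g0 hg0).trans measureReal_le_one
    rw [Real.exp_le_one_iff] at this
    linarith
  have hk : 1 / (n:ℝ) * (1 / (1 - a) ^ 2) ≤ √(n * d) := by
    rw [← hkk]
    have h2 : 1 / n * k ≤ k := mul_le_of_le_one_left hk0 (by rw [div_le_one hn']; exact hn1)
    refine h2.trans (Real.le_sqrt_of_sq_le ?_)
    rwa [div_le_iff₀ hd0] at hnk
  have hprob : (gam n).real (typ a σ d θ q n)ᶜ + (1 - exp (-F)) ^ ⌈exp F * l⌉₊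
      + 2 * σ * (∫ y, |y| ^ 1 ∂(gaussianReal 0 1)) / n ≤ ε := by
    rw [← hK]
    have h1 := pow_bd (l := l) hF0
    rw [hexpl] at h1
    have h2 : (1 + K) / n ≤ c0 / √l := by
      rw [div_le_div_iff₀ hn' (by linarith)]
      rw [pow_one, ← hl, div_le_div_iff₀ (by linarith) (by linarith)] at hd1
      have h3 : c0 * √n ≤ c0 * n := mul_le_mul_of_nonneg_left (by
        calc √(n:ℝ) ≤ √n * √n := le_mul_of_one_le_left (by linarith) hsn
          _ = n := hsq) hc0.le
      have h4 : (1 + K) * √l ≤ (1 + K) * l := mul_le_mul_of_nonneg_left hslle (by linarith)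
      linarith
    rw [add_div] at h2
    linarith
  have hr := build ha0 ha1 hσ hd0 n hn ⌈exp F * l⌉₊ (Nat.ceil_pos.2 (by positivity)) (exp (-F))
    (Real.exp_le_one_iff.2 (by linarith)) hk hball hprob
  refine hr.trans ?_
  have hM := logM hF0 hl0 n hn hl
  have h1 : C * (√n / l) ≤ C * (√n / √l) :=
    mul_le_mul_of_nonneg_left (div_le_div_of_nonneg_left (by linarith) (by linarith) hslle) hC
  have h2 : l ≤ √n / √l := by
    rw [le_div_iff₀ (by linarith)]
    rw [← hl, div_le_iff₀ (by linarith), one_mul] at hd2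
    calc l * √l ≤ l * l := mul_le_mul_of_nonneg_left hslle (by linarith)
      _ = l ^ 2 := by ring
      _ ≤ _ := hd2
  have h3 : log ((⌈exp F * l⌉₊ * (2 * n ^ 3 + 1) : ℕ) : ℝ) ≤ n * GM.RU a σ θ + √(n * GM.VU a σ θ) * q + (7 + C) * (√n / √l) := by
    rw [hF] at hM ⊢
    linarith
  refine (div_le_div_of_nonneg_right h3 hn'.le).trans (le_of_eq ?_)
  rw [← hl]
  have e1 : √(GM.VU a σ θ / n) = √(n * GM.VU a σ θ) / n := by
    have : GM.VU a σ θ / n = n * GM.VU a σ θ / (n ^ 2) := by field_simp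
    rw [this, Real.sqrt_div (by positivity), Real.sqrt_sq hn'.le]
  have e2 : (7 + C) / (√l * √n) = (7 + C) * (√n / √l) / n := by
    have hl' : √l ≠ 0 := by positivity
    have hn'' : √(n:ℝ) ≠ 0 := by positivity
    rw [div_eq_div_iff (by positivity) hn'.ne', ← mul_div_assoc, div_mul_eq_mul_div, eq_div_iff hl']
    linear_combination (-(7 + C) * √l) * hsq
  rw [e1, e2]; field_simp

end GMX
end

theorem stmt14 (a σ ε d θ Qinv : ℝ)
    (ha0 : 0 ≤ a) (ha1 : a < 1) (hσ : 0 < σ)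
    (hε : ε ∈ Set.Ioo (0 : ℝ) 1)
    (hd0 : 0 < d) (hdmax : d < σ ^ 2 / (1 - a ^ 2))
    (hθ : 0 < θ) (hwater : GM.waterEq a σ θ d)
    (hQinv : GM.gaussQ Qinv = ε) :
    ∀ α : ℝ, 0 < α → ∃ κ C : ℝ, 0 < κ ∧ 0 < C ∧
      ∀ᶠ n : ℕ in Filter.atTop,
        GM.rate a σ n d ε ≤
          GM.RU a σ θ + Real.sqrt (GM.VU a σ θ / n) * Qinv
            + C / (Real.log n ^ (κ * α) * Real.sqrt n) := by
  intro α hα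
  obtain ⟨C, hC, h⟩ := GMX.final ha0 ha1 hσ hε.2 hd0 hdmax hθ hwater hQinv
  refine ⟨1 / (2 * α), C, by positivity, hC, ?_⟩
  have e : 1 / (2 * α) * α = 1 / 2 := by field_simp
  filter_upwards [h] with n hn
  rw [e, ← Real.sqrt_eq_rpow]
  exact hn

end
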